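/- Let N be a finitely presented Λ-module which is indecomposable and not projective, and let P₁ → P₀ → N → 0 be a minimal projective presentation by finitely generated projective Λ-modules, i.e. P₀ → N and P₁ → ker(P₀ → N) are projective covers (surjections whose kernel is a superfluous submodule, where a submodule S of a module P is superfluous if S + L = P implies L = P for every submodule L of P). Then there exists an almost split sequence 0 → D Tr N → Y → N → 0 in the category of Λ-modules, where D Tr N is computed from this presentation. -/

import Mathlib

open CategoryTheory

universe u

section DTr

variable (k : Type u) [CommRing k] (Λ : Type u) [Ring Λ] [Algebra k Λ]
variable (E : Type u) [AddCommGroup E] [Module k E]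

/-- The (left) `Λ`-module structure on `D T = Hom_k(T, E)` for a right `Λ`-module
(i.e. `Λᵐᵒᵖ`-module) `T`, given by `(a • g) t = g (t • a)`. -/
noncomputable instance DMod.module (T : Type u) [AddCommGroup T] [Module Λᵐᵒᵖ T]
    [Module k T] [SMulCommClass Λᵐᵒᵖ k T] : Module Λ (T →ₗ[k] E) where
  smul a g := g ∘ₗ (DistribMulAction.toLinearMap k T (MulOpposite.op a))
  one_smul g := by
    ext t
    show g ((MulOpposite.op (1 : Λ)) • t) = g t
    rw [MulOpposite.op_one, one_smul]
  mul_smul a b g := by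
    ext t
    show g ((MulOpposite.op (a * b)) • t) = g ((MulOpposite.op b) • (MulOpposite.op a) • t)
    rw [MulOpposite.op_mul, mul_smul]
  smul_zero a := by ext t; rfl
  smul_add a g h := by ext t; rfl
  add_smul a b g := by
    ext t
    show g ((MulOpposite.op (a + b)) • t) =
      g ((MulOpposite.op a) • t) + g ((MulOpposite.op b) • t)
    rw [MulOpposite.op_add, add_smul, map_add]
  zero_smul g := by
    ext t
    show g ((MulOpposite.op (0 : Λ)) • t) = 0
    rw [MulOpposite.op_zero, zero_smul, map_zero]

instance DMod.smulCommClass (T : Type u) [AddCommGroup T] [Module Λᵐᵒᵖ T]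
    [Module k T] [SMulCommClass Λᵐᵒᵖ k T] : SMulCommClass Λ k (T →ₗ[k] E) :=
  ⟨fun _ _ _ => LinearMap.ext fun _ => rfl⟩

variable {Λ} in
/-- The transpose `Tr M` of a finitely presented module `M` with projective presentation
`P₁ → P₀ → M → 0`: the cokernel of `Hom_Λ(P₀, Λ) → Hom_Λ(P₁, Λ)`, a right `Λ`-module
(i.e. `Λᵐᵒᵖ`-module). -/
abbrev transposeOf {P₁ P₀ : Type u} [AddCommGroup P₁] [Module Λ P₁]
    [AddCommGroup P₀] [Module Λ P₀] (d : P₁ →ₗ[Λ] P₀) : Type u :=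
  (P₁ →ₗ[Λ] Λ) ⧸ LinearMap.range
    ({ toFun := fun φ : (P₀ →ₗ[Λ] Λ) => φ.comp d
       map_add' := fun _ _ => LinearMap.add_comp _ _ _
       map_smul' := fun _ _ => rfl } : (P₀ →ₗ[Λ] Λ) →ₗ[Λᵐᵒᵖ] (P₁ →ₗ[Λ] Λ))

variable {k Λ E} in
/-- The submodule of `Hom_Λ(N, X)` of homomorphisms factoring through an injective
`Λ`-module. -/
noncomputable def factorsThroughInjective (N X : Type u) [AddCommGroup N] [Module Λ N]
    [AddCommGroup X] [Module Λ X] [Module k X] [SMulCommClass Λ k X] :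
    Submodule k (N →ₗ[Λ] X) :=
  Submodule.span k {f | ∃ (I : ModuleCat.{u} Λ) (_ : Injective I)
    (g : N →ₗ[Λ] I) (h : I →ₗ[Λ] X), f = h ∘ₗ g}

end DTr

section AlmostSplit

variable {Λ : Type u} [Ring Λ]

/-- A submodule `S ⊆ P` is *superfluous* if `S + L = P` implies `L = P` for every
submodule `L` of `P`. -/
def IsSuperfluousSubmodule {P : Type u} [AddCommGroup P] [Module Λ P]
    (S : Submodule Λ P) : Prop :=
  ∀ L : Submodule Λ P, S ⊔ L = ⊤ → L = ⊤

/-- A `Λ`-linear map `α : X → Y` is *left almost split* if it is not a section and every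
map `X → Y'` which is not a section factors through it. -/
def IsLeftAlmostSplitMap {X Y : Type u} [AddCommGroup X] [Module Λ X]
    [AddCommGroup Y] [Module Λ Y] (α : X →ₗ[Λ] Y) : Prop :=
  (¬ ∃ r : Y →ₗ[Λ] X, r ∘ₗ α = LinearMap.id) ∧
    ∀ (Y' : Type u) (_ : AddCommGroup Y') (_ : Module Λ Y') (f : X →ₗ[Λ] Y'),
      (¬ ∃ r : Y' →ₗ[Λ] X, r ∘ₗ f = LinearMap.id) → ∃ g : Y →ₗ[Λ] Y', g ∘ₗ α = f

/-- A `Λ`-linear map `β : Y → Z` is *right almost split* if it is not a retraction and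
every map `Y' → Z` which is not a retraction factors through it. -/
def IsRightAlmostSplitMap {Y Z : Type u} [AddCommGroup Y] [Module Λ Y]
    [AddCommGroup Z] [Module Λ Z] (β : Y →ₗ[Λ] Z) : Prop :=
  (¬ ∃ s : Z →ₗ[Λ] Y, β ∘ₗ s = LinearMap.id) ∧
    ∀ (Y' : Type u) (_ : AddCommGroup Y') (_ : Module Λ Y') (f : Y' →ₗ[Λ] Z),
      (¬ ∃ s : Z →ₗ[Λ] Y', f ∘ₗ s = LinearMap.id) → ∃ g : Y' →ₗ[Λ] Y, β ∘ₗ g = f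

end AlmostSplit

section LocalAlgebra

open Polynomial in
/-- Idempotents lift along a Henselian pair. -/
theorem HenselianRing.exists_isIdempotentElem_sub_mem {A : Type*} [CommRing A] (I : Ideal A)
    [HenselianRing A I] (a : A) (ha : a * a - a ∈ I) :
    ∃ e : A, IsIdempotentElem e ∧ e - a ∈ I := by
  nontriviality A
  have hmonic : (X ^ 2 - X : A[X]).Monic := by monicity!
  have hunit : IsUnit (Ideal.Quotient.mk I ((X ^ 2 - X : A[X]).derivative.eval a)) := by
    have h0 : Ideal.Quotient.mk I (a * a - a) = 0 := Ideal.Quotient.eq_zero_iff_mem.mpr ha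
    refine IsUnit.of_mul_eq_one (Ideal.Quotient.mk I ((X ^ 2 - X : A[X]).derivative.eval a)) ?_
    have : ((X ^ 2 - X : A[X]).derivative.eval a) * ((X ^ 2 - X : A[X]).derivative.eval a) =
        1 + 4 * (a * a - a) := by
      simp
      ring
    rw [← map_mul, this, map_add, map_mul, h0]
    simp
  obtain ⟨e, he, hea⟩ := HenselianRing.is_henselian (I := I) _ hmonic a
    (by simpa [sq] using ha) hunit
  refine ⟨e, ?_, hea⟩
  have : e * e = e := by simpa [IsRoot, sq, sub_eq_zero] using he
  exact this

/-- A finite module over a complete noetherian local ring is complete. -/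
theorem IsAdicComplete.of_finite_of_isLocalRing {k : Type*} [CommRing k] [IsNoetherianRing k]
    [IsLocalRing k] [IsAdicComplete (IsLocalRing.maximalIdeal k) k]
    (M : Type*) [AddCommGroup M] [Module k M] [Module.Finite k M] :
    IsAdicComplete (IsLocalRing.maximalIdeal k) M where
  toIsHausdorff := inferInstance
  toIsPrecomplete := by
    rw [← AdicCompletion.of_surjective_iff]
    intro x
    obtain ⟨z, rfl⟩ := AdicCompletion.ofTensorProduct_surjective_of_finite
      (IsLocalRing.maximalIdeal k) M x
    induction z with
    | zero => exact ⟨0, by simp⟩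
    | add y z hy hz =>
      obtain ⟨a, ha⟩ := hy
      obtain ⟨b, hb⟩ := hz
      exact ⟨a + b, by simp [ha, hb]⟩
    | tmul r m =>
      obtain ⟨s, rfl⟩ := AdicCompletion.of_surjective (IsLocalRing.maximalIdeal k) k r
      refine ⟨s • m, ?_⟩
      rw [AdicCompletion.ofTensorProduct_tmul]
      ext n
      rfl

/-- A finite module annihilated by a power of the maximal ideal is artinian. -/
theorem isArtinian_of_maximalIdeal_le_radical_annihilator {k : Type*} [CommRing k]
    [IsNoetherianRing k] [IsLocalRing k] (M : Type*) [AddCommGroup M] [Module k M]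
    [Module.Finite k M]
    (h : IsLocalRing.maximalIdeal k ≤ (Module.annihilator k M).radical) : IsArtinian k M := by
  set I := Module.annihilator k M with hI
  have : IsArtinianRing (k ⧸ I) := by
    rcases subsingleton_or_nontrivial (k ⧸ I) with hs | hn
    · infer_instance
    · have := IsLocalRing.of_surjective' (Ideal.Quotient.mk I) Ideal.Quotient.mk_surjective
      rw [isArtinianRing_iff_isNilpotent_maximalIdeal]
      obtain ⟨n, hn⟩ := Ideal.exists_pow_le_of_le_radical_of_fg h
        ((isNoetherianRing_iff_ideal_fg k).mp ‹_› _)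
      refine ⟨n, ?_⟩
      have hmap : (IsLocalRing.maximalIdeal k).map (Ideal.Quotient.mk I) =
          IsLocalRing.maximalIdeal (k ⧸ I) := by
        have := IsLocalHom.of_surjective (Ideal.Quotient.mk I) Ideal.Quotient.mk_surjective
        ext x
        obtain ⟨x, rfl⟩ := Ideal.Quotient.mk_surjective x
        simp [sup_eq_left.mpr (IsLocalRing.le_maximalIdeal (Ideal.Quotient.nontrivial_iff.mp ‹_›))]
      rw [← hmap, ← Ideal.map_pow, Ideal.zero_eq_bot, Ideal.map_eq_bot_iff_le_ker, Ideal.mk_ker]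
      exact hn
  have ht : Module.IsTorsionBySet k M I := (Module.isTorsionBySet_annihilator k M)
  let := ht.module
  have : IsScalarTower k (k ⧸ I) M := ht.isScalarTower
  have : Module.Finite (k ⧸ I) M := Module.Finite.of_restrictScalars_finite k _ _
  exact isArtinian_of_surjective_algebraMap (R := k ⧸ I) (M := M) Ideal.Quotient.mk_surjective

/-- A finite commutative algebra over a complete noetherian local ring without nontrivial
idempotents is local. -/
theorem isUnit_or_isUnit_one_sub_of_isIdempotentElem_comm {k : Type*} [CommRing k]
    [IsNoetherianRing k] [IsLocalRing k] [IsAdicComplete (IsLocalRing.maximalIdeal k) k]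
    {A : Type*} [CommRing A] [Algebra k A] [Module.Finite k A]
    (hA : ∀ e : A, IsIdempotentElem e → e = 0 ∨ e = 1) (a : A) :
    IsUnit a ∨ IsUnit (1 - a) := by
  let I : Ideal A := (IsLocalRing.maximalIdeal k).map (algebraMap k A)
  have hc : IsAdicComplete (IsLocalRing.maximalIdeal k) A :=
    IsAdicComplete.of_finite_of_isLocalRing A
  have : IsAdicComplete I A := (IsAdicComplete.map_algebraMap_iff _ _).mpr hc
  have hjac : I ≤ Ideal.jacobson ⊥ := IsAdicComplete.le_jacobson_bot I
  have hlift (a : A) (ha : IsUnit (Ideal.Quotient.mk I a)) : IsUnit a := by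
    obtain ⟨b, hb⟩ := Ideal.Quotient.mk_surjective (↑ha.unit⁻¹ : A ⧸ I)
    have h1 : a * b - 1 ∈ I := by
      rw [← Ideal.Quotient.eq_zero_iff_mem, map_sub, map_mul, hb, map_one]
      simp
    have := Ideal.mem_jacobson_bot.mp (hjac h1) 1
    exact isUnit_of_mul_isUnit_left (y := b) (by simpa using this)
  have hart : IsArtinianRing (A ⧸ I) := by
    have : IsArtinian k (A ⧸ I) := by
      apply isArtinian_of_maximalIdeal_le_radical_annihilator
      intro r hr
      apply Ideal.le_radical
      rw [Module.mem_annihilator]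
      intro x
      obtain ⟨x, rfl⟩ := Ideal.Quotient.mk_surjective x
      have : r • Ideal.Quotient.mk I x = Ideal.Quotient.mk I (r • x) := rfl
      rw [this, Ideal.Quotient.eq_zero_iff_mem, Algebra.smul_def]
      exact I.mul_mem_right _ (Ideal.mem_map_of_mem _ hr)
    exact isArtinian_of_tower k this
  set b : A ⧸ I := Ideal.Quotient.mk I a with hb
  obtain ⟨n, y, hy⟩ := IsArtinian.exists_pow_succ_smul_dvd b (1 : A ⧸ I)
  have hy1 : b ^ n * (b * y) = b ^ n := by
    simpa only [smul_eq_mul, Nat.succ_eq_add_one, pow_succ, mul_assoc, mul_one] using hy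
  have hyn (m : ℕ) : b ^ n * (b * y) ^ m = b ^ n := by
    induction m with
    | zero => simp
    | succ m ih => rw [pow_succ, ← mul_assoc, ih, hy1]
  obtain ⟨z, hz⟩ := Ideal.Quotient.mk_surjective ((b * y) ^ n)
  have hidem : Ideal.Quotient.mk I (z * z - z) = 0 := by
    have h2 : (b * y) ^ n * (b * y) ^ n = (b ^ n * (b * y) ^ n) * y ^ n := by ring
    rw [map_sub, map_mul, hz, h2, hyn n, mul_pow, sub_self]
  obtain ⟨e, he, hez⟩ := HenselianRing.exists_isIdempotentElem_sub_mem I z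
    (Ideal.Quotient.eq_zero_iff_mem.mp hidem)
  have hez' : Ideal.Quotient.mk I e = (b * y) ^ n := by
    rw [← hz]
    exact Ideal.Quotient.eq.mpr hez
  rcases hA e he with rfl | rfl
  · right
    apply hlift
    rw [map_sub, map_one, ← hb]
    refine IsNilpotent.isUnit_one_sub ⟨n, ?_⟩
    rw [← hyn n, ← hez', map_zero, mul_zero]
  · left
    apply hlift
    rw [← hb]
    rcases n with _ | n
    · exact IsUnit.of_mul_eq_one y (by simpa only [pow_zero, one_mul] using hy1)
    · exact IsUnit.of_mul_eq_one (y * (b * y) ^ n)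
        (by rw [← mul_assoc, ← pow_succ', ← hez', map_one])

/-- A finite algebra over a complete noetherian local ring without nontrivial idempotents is
local. -/
theorem isUnit_or_isUnit_one_sub_of_isIdempotentElem {k : Type*} [CommRing k] [IsNoetherianRing k]
    [IsLocalRing k] [IsAdicComplete (IsLocalRing.maximalIdeal k) k]
    {Γ : Type*} [Ring Γ] [Algebra k Γ] [Module.Finite k Γ]
    (hΓ : ∀ e : Γ, IsIdempotentElem e → e = 0 ∨ e = 1) (c : Γ) :
    IsUnit c ∨ IsUnit (1 - c) := by
  let A := Algebra.adjoin k {c}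
  have : IsMulCommutative A := Algebra.isMulCommutative_adjoin k (by simp)
  have hfin : Module.Finite k A := inferInstanceAs (Module.Finite k (Subalgebra.toSubmodule A))
  have hA (e : A) (he : IsIdempotentElem e) : e = 0 ∨ e = 1 :=
    (hΓ e.1 (congrArg Subtype.val he)).imp (fun h => Subtype.ext h) (fun h => Subtype.ext h)
  exact (isUnit_or_isUnit_one_sub_of_isIdempotentElem_comm (k := k) hA
    ⟨c, Algebra.subset_adjoin rfl⟩).imp (fun h => h.map A.val)
      (fun h => by simpa using h.map A.val)

end LocalAlgebra

section MatlisDual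

open IsLocalRing

variable {k : Type*} [CommRing k] [IsLocalRing k] {E : Type*} [AddCommGroup E] [Module k E]
  {ι : (k ⧸ maximalIdeal k) →ₗ[k] E}

theorem exists_smul_ne_zero_mem_range_of_essential
    (hess : ∀ L : Submodule k E, L ⊓ LinearMap.range ι = ⊥ → L = ⊥) {x : E} (hx : x ≠ 0) :
    ∃ s : k, s • x ≠ 0 ∧ s • x ∈ LinearMap.range ι := by
  by_contra! h
  refine hx (Submodule.span_singleton_eq_bot.mp (hess (k ∙ x) ?_))
  rw [Submodule.eq_bot_iff]
  rintro y ⟨hy, hy'⟩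
  obtain ⟨s, rfl⟩ := Submodule.mem_span_singleton.mp hy
  by_contra hs
  exact h s hs hy'

theorem smul_eq_zero_of_mem_range {r : k} (hr : r ∈ maximalIdeal k) {x : E}
    (hx : x ∈ LinearMap.range ι) : r • x = 0 := by
  obtain ⟨y, rfl⟩ := hx
  obtain ⟨y, rfl⟩ := Ideal.Quotient.mk_surjective y
  have : r • Ideal.Quotient.mk (maximalIdeal k) y =
    Ideal.Quotient.mk (maximalIdeal k) (r * y) := rfl
  rw [← map_smul, this, Ideal.Quotient.eq_zero_iff_mem.mpr (Ideal.mul_mem_right _ _ hr), map_zero]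

theorem mem_range_of_maximalIdeal_smul_eq_zero
    (hess : ∀ L : Submodule k E, L ⊓ LinearMap.range ι = ⊥ → L = ⊥) {x : E}
    (hx : ∀ r ∈ maximalIdeal k, r • x = 0) : x ∈ LinearMap.range ι := by
  by_cases h0 : x = 0
  · rw [h0]
    exact zero_mem _
  obtain ⟨s, hs, hmem⟩ := exists_smul_ne_zero_mem_range_of_essential hess h0
  have hu : IsUnit s := by
    by_contra h
    exact hs (hx s h)
  rw [← one_smul k x, ← hu.val_inv_mul, mul_smul]
  exact Submodule.smul_mem _ _ hmem

theorem exists_pow_smul_linearMap_eq_zero [IsNoetherianRing k]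
    (hess : ∀ L : Submodule k E, L ⊓ LinearMap.range ι = ⊥ → L = ⊥)
    {G : Type*} [AddCommGroup G] [Module k G] [Module.Finite k G] (g : G →ₗ[k] E) {r : k}
    (hr : r ∈ maximalIdeal k) : ∃ n : ℕ, r ^ n • g = 0 := by
  obtain ⟨n, hn⟩ := monotone_stabilizes_iff_noetherian.mpr (inferInstanceAs (IsNoetherian k G))
    ⟨fun n => LinearMap.ker (r ^ n • g), monotone_nat_of_le_succ fun n x hx => by
      rw [LinearMap.mem_ker] at hx ⊢
      rw [pow_succ', mul_smul, LinearMap.smul_apply, hx, smul_zero]⟩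
  refine ⟨n, LinearMap.ext fun t => ?_⟩
  by_contra h
  obtain ⟨s, hs, hmem⟩ := exists_smul_ne_zero_mem_range_of_essential hess h
  apply hs
  have h1 : s • t ∈ LinearMap.ker (r ^ (n + 1) • g) := by
    rw [LinearMap.mem_ker, map_smul, pow_succ', mul_smul, LinearMap.smul_apply, smul_comm]
    exact smul_eq_zero_of_mem_range hr hmem
  have h2 : s • t ∈ LinearMap.ker (r ^ n • g) := by
    have := hn (n + 1) n.le_succ
    change LinearMap.ker (r ^ n • g) = LinearMap.ker (r ^ (n + 1) • g) at this
    rwa [this]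
  rwa [LinearMap.mem_ker, map_smul] at h2

/-- Finitely generated submodules of the Matlis dual of a finite module are artinian. -/
theorem isArtinian_of_injective_linearMap [IsNoetherianRing k]
    (hess : ∀ L : Submodule k E, L ⊓ LinearMap.range ι = ⊥ → L = ⊥)
    {G : Type*} [AddCommGroup G] [Module k G] [Module.Finite k G]
    {S : Type*} [AddCommGroup S] [Module k S] [Module.Finite k S]
    (j : S →ₗ[k] G →ₗ[k] E) (hj : Function.Injective j) : IsArtinian k S := by
  apply isArtinian_of_maximalIdeal_le_radical_annihilator
  intro r hr
  obtain ⟨n, hn⟩ := monotone_stabilizes_iff_noetherian.mpr (inferInstanceAs (IsNoetherian k S))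
    ⟨fun n => LinearMap.ker (LinearMap.lsmul k S (r ^ n)),
      monotone_nat_of_le_succ fun n x hx => by
      rw [LinearMap.mem_ker] at hx ⊢
      rw [pow_succ', LinearMap.lsmul_apply, mul_smul, ← LinearMap.lsmul_apply (r ^ n), hx,
        smul_zero]⟩
  refine ⟨n, Module.mem_annihilator.mpr fun x => ?_⟩
  obtain ⟨m, hm⟩ := exists_pow_smul_linearMap_eq_zero hess (j x) hr
  have h1 : x ∈ LinearMap.ker (LinearMap.lsmul k S (r ^ (n + m))) := by
    rw [LinearMap.mem_ker, LinearMap.lsmul_apply]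
    apply hj
    rw [map_smul, pow_add, mul_smul, hm, smul_zero, map_zero]
  have := hn (n + m) (Nat.le_add_right n m)
  change LinearMap.ker (LinearMap.lsmul k S (r ^ n)) = _ at this
  change x ∈ LinearMap.ker (LinearMap.lsmul k S (r ^ n))
  rw [this]
  exact h1

end MatlisDual

section LocalAlgebraDual

open IsLocalRing

theorem IsLocalRing.isDedekindFiniteMonoid (Γ : Type*) [Ring Γ] [IsLocalRing Γ] :
    IsDedekindFiniteMonoid Γ where
  mul_eq_one_symm {a b} hab := by
    rcases isUnit_or_isUnit_of_add_one (add_sub_cancel (b * a) 1) with h | h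
    · apply h.mul_left_cancel
      rw [mul_one, mul_assoc, ← mul_assoc a, hab, one_mul]
    · have hb : b = 0 := by
        apply h.mul_left_cancel
        rw [mul_zero, sub_mul, one_mul, mul_assoc, hab, mul_one, sub_self]
      rw [hb, mul_zero] at hab
      exact absurd hab zero_ne_one

theorem not_isUnit_smul_of_mem_maximalIdeal {k : Type*} [CommRing k] [IsLocalRing k]
    {Γ : Type*} [Ring Γ] [IsLocalRing Γ] [Algebra k Γ] [Module.Finite k Γ] {r : k}
    (hr : r ∈ maximalIdeal k) (x : Γ) : ¬ IsUnit (r • x) := by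
  rintro ⟨u, hu⟩
  have htop : (⊤ : Submodule k Γ) ≤ maximalIdeal k • ⊤ := by
    intro y _
    have : y = r • (x * (↑u⁻¹ * y)) := by
      rw [← smul_mul_assoc, ← hu, Units.mul_inv_cancel_left]
    rw [this]
    exact Submodule.smul_mem_smul hr trivial
  have := Submodule.eq_bot_of_le_smul_of_le_jacobson_bot _ _ Module.Finite.fg_top htop
    (IsLocalRing.jacobson_eq_maximalIdeal _ bot_ne_top).ge
  exact bot_ne_top this.symm

/-- The nonunits of a local algebra as a submodule over the base ring. -/
def nonunitsSubmodule (k Γ : Type*) [CommRing k] [Ring Γ] [IsLocalRing Γ] [Algebra k Γ] :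
    Submodule k Γ where
  __ := nonunitsAddSubmonoid Γ
  smul_mem' r x hx := by
    have := IsLocalRing.isDedekindFiniteMonoid Γ
    intro h
    rw [Algebra.smul_def] at h
    exact hx (isUnit_of_mul_isUnit_right h)

/-- The Matlis dual of a finite local algebra `Γ` has an essential simple socle. -/
theorem exists_generator_socle_dual {k : Type*} [CommRing k] [IsNoetherianRing k] [IsLocalRing k]
    {E : Type*} [AddCommGroup E] [Module k E]
    {ι : (k ⧸ maximalIdeal k) →ₗ[k] E} (hι : Function.Injective ι)
    (hess : ∀ L : Submodule k E, L ⊓ LinearMap.range ι = ⊥ → L = ⊥)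
    (Γ : Type*) [Ring Γ] [IsLocalRing Γ] [Algebra k Γ] [Module.Finite k Γ] :
    ∃ φ : Γ →ₗ[k] E, φ 1 ≠ 0 ∧ (∀ c, ¬ IsUnit c → φ c = 0) ∧
      ∀ ψ : Γ →ₗ[k] E, ψ ≠ 0 → ∃ γ, ∀ δ, ψ (γ * δ) = φ δ := by
  have hded := IsLocalRing.isDedekindFiniteMonoid Γ
  let J := nonunitsSubmodule k Γ
  let V := Γ ⧸ J
  have htors : Module.IsTorsionBySet k V (maximalIdeal k) := by
    rintro v ⟨r, hr⟩
    obtain ⟨x, rfl⟩ := J.mkQ_surjective v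
    rw [← map_smul]
    exact (Submodule.Quotient.mk_eq_zero J).mpr (not_isUnit_smul_of_mem_maximalIdeal hr x)
  let κ := k ⧸ maximalIdeal k
  let : Field κ := Ideal.Quotient.field _
  let : Module κ V := htors.module
  have : IsScalarTower k κ V := htors.isScalarTower
  have hsurj : Function.Surjective (algebraMap k κ) := Ideal.Quotient.mk_surjective
  have hVfin : Module.Finite κ V := Module.Finite.of_restrictScalars_finite k _ _
  have hdual (χ : Γ →ₗ[k] E) (hχ : ∀ c, ¬ IsUnit c → χ c = 0) :
      ∃ l : V →ₗ[k] κ, ∀ c, ι (l (J.mkQ c)) = χ c := by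
    have hmem (c : Γ) : χ c ∈ LinearMap.range ι := by
      apply mem_range_of_maximalIdeal_smul_eq_zero hess
      intro r hr
      rw [← map_smul]
      exact hχ _ (not_isUnit_smul_of_mem_maximalIdeal hr c)
    let χ' : Γ →ₗ[k] κ := (LinearEquiv.ofInjective ι hι).symm.toLinearMap ∘ₗ χ.codRestrict _ hmem
    have hχ' (c : Γ) : ι (χ' c) = χ c := by
      have := (LinearEquiv.ofInjective ι hι).apply_symm_apply ⟨χ c, hmem c⟩
      exact congrArg Subtype.val this
    refine ⟨J.liftQ χ' fun c hc => ?_, fun c => ?_⟩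
    · rw [LinearMap.mem_ker]
      apply hι
      rw [hχ', hχ c hc, map_zero]
    · rw [Submodule.mkQ_apply, Submodule.liftQ_apply, hχ']
  have h1 : J.mkQ 1 ≠ 0 := fun h =>
    (Submodule.Quotient.mk_eq_zero J).mp h isUnit_one
  obtain ⟨l, hl⟩ := Module.Projective.exists_dual_ne_zero κ h1
  refine ⟨ι ∘ₗ l.restrictScalars k ∘ₗ J.mkQ, ?_, ?_, ?_⟩
  · intro h
    exact hl (hι (h.trans (map_zero ι).symm))
  · intro c hc
    have : J.mkQ c = 0 := (Submodule.Quotient.mk_eq_zero J).mpr hc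
    simp only [LinearMap.comp_apply, this, map_zero]
  intro ψ hψ
  -- a translate of `ψ` lying in the socle
  obtain ⟨γ₁, hγ₁, hγ₁J⟩ : ∃ γ₁, (∃ δ, ψ (γ₁ * δ) ≠ 0) ∧
      ∀ c, ¬ IsUnit c → ∀ δ, ψ (γ₁ * (c * δ)) = 0 := by
    let T : Γ →ₗ[k] Γ →ₗ[k] E := (LinearMap.mul k Γ).compr₂ ψ
    have hT (γ δ : Γ) : T γ δ = ψ (γ * δ) := rfl
    have hart : IsArtinian k (LinearMap.range T) :=
      isArtinian_of_injective_linearMap hess (LinearMap.range T).subtype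
        (Submodule.injective_subtype _)
    let orbit (γ : Γ) : Submodule k (LinearMap.range T) :=
      LinearMap.range (T.rangeRestrict ∘ₗ LinearMap.mulLeft k γ)
    obtain ⟨_, ⟨γ, hγ, rfl⟩, hmin⟩ := IsArtinian.set_has_minimal
      (orbit '' {γ | T γ ≠ 0}) ⟨_, 1, by
        simpa [LinearMap.ext_iff, hT] using hψ, rfl⟩
    refine ⟨γ, ?_, ?_⟩
    · by_contra! h
      exact hγ (LinearMap.ext h)
    intro c hc
    suffices h : T (γ * c) = 0 by
      intro δ
      rw [← mul_assoc, ← hT, h, LinearMap.zero_apply]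
    by_contra h
    have hle : orbit (γ * c) ≤ orbit γ := by
      rintro _ ⟨δ, rfl⟩
      exact ⟨c * δ, Subtype.ext (congrArg T (mul_assoc γ c δ).symm)⟩
    have heq : orbit (γ * c) = orbit γ :=
      hle.eq_of_not_lt (hmin _ ⟨γ * c, h, rfl⟩)
    have hmem : T.rangeRestrict γ ∈ orbit (γ * c) := by
      rw [heq]
      exact ⟨1, Subtype.ext (congrArg T (mul_one γ))⟩
    obtain ⟨δ, hδ⟩ := hmem
    have hδ' : T (γ * c * δ) = T γ := congrArg Subtype.val hδ
    have hu : IsUnit (1 - c * δ) :=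
      (isUnit_or_isUnit_of_add_one (add_sub_cancel (c * δ) 1)).resolve_left fun h =>
        hc (isUnit_of_mul_isUnit_left h)
    apply hγ
    ext x
    obtain ⟨u, hu⟩ := hu
    have key : T γ ((1 - c * δ) * (↑u⁻¹ * x)) = 0 := by
      have := LinearMap.congr_fun hδ' (↑u⁻¹ * x)
      rw [hT, hT] at this
      rw [hT, sub_mul, one_mul, mul_sub, map_sub, ← this, sub_eq_zero]
      simp only [mul_assoc]
    rwa [← hu, Units.mul_inv_cancel_left] at key
  obtain ⟨m, hm⟩ := hdual (ψ ∘ₗ LinearMap.mulLeft k γ₁) fun c hc => by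
    simpa using hγ₁J c hc 1
  replace hm (c : Γ) : ι (m (J.mkQ c)) = ψ (γ₁ * c) := hm c
  have hmzero (γ c : Γ) (h : ¬ IsUnit γ ∨ ¬ IsUnit c) : m (J.mkQ (γ * c)) = 0 := by
    apply hι
    rw [hm, map_zero]
    have : ¬ IsUnit (γ * c) := fun hu => h.elim (fun h => h (isUnit_of_mul_isUnit_left hu))
      (fun h => h (isUnit_of_mul_isUnit_right hu))
    simpa using hγ₁J _ this 1
  let F : Γ →ₗ[k] V →ₗ[k] κ :=
    { toFun := fun γ => J.liftQ (m ∘ₗ J.mkQ ∘ₗ LinearMap.mulLeft k γ)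
        fun c hc => hmzero γ c (Or.inr hc)
      map_add' := fun a b => by
        ext c
        change m (J.mkQ ((a + b) * c)) = m (J.mkQ (a * c)) + m (J.mkQ (b * c))
        rw [add_mul, map_add, map_add]
      map_smul' := fun a b => by
        ext c
        change m (J.mkQ ((a • b) * c)) = a • m (J.mkQ (b * c))
        rw [smul_mul_assoc, map_smul, map_smul] }
  have hF (γ c : Γ) : F γ (J.mkQ c) = m (J.mkQ (γ * c)) := rfl
  let B : V →ₗ[k] V →ₗ[k] κ := J.liftQ F fun γ hγ => by
    rw [LinearMap.mem_ker]
    ext c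
    exact hmzero γ c (Or.inl hγ)
  have hB (γ c : Γ) : B (J.mkQ γ) (J.mkQ c) = m (J.mkQ (γ * c)) := rfl
  let B' : V →ₗ[κ] Module.Dual κ V :=
    ((LinearMap.extendScalarsOfSurjectiveEquiv hsurj).toLinearMap ∘ₗ B).extendScalarsOfSurjective
      hsurj
  have hB' (γ c : Γ) : B' (J.mkQ γ) (J.mkQ c) = m (J.mkQ (γ * c)) := rfl
  have hinj : Function.Injective B' := by
    rw [injective_iff_map_eq_zero]
    intro v hv
    obtain ⟨γ, rfl⟩ := J.mkQ_surjective v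
    by_contra h
    have hu : IsUnit γ := by
      by_contra hu
      exact h ((Submodule.Quotient.mk_eq_zero J).mpr hu)
    obtain ⟨u, rfl⟩ := hu
    obtain ⟨δ, hδ⟩ := hγ₁
    apply hδ
    have := LinearMap.congr_fun hv (J.mkQ (↑u⁻¹ * δ))
    rw [hB', Units.mul_inv_cancel_left, LinearMap.zero_apply] at this
    rw [← hm, this, map_zero]
  have hsurjB : Function.Surjective B' :=
    (LinearMap.injective_iff_surjective_of_finrank_eq_finrank
      Subspace.dual_finrank_eq.symm).mp hinj
  obtain ⟨v, hv⟩ := hsurjB l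
  obtain ⟨γ, rfl⟩ := J.mkQ_surjective v
  refine ⟨γ₁ * γ, fun δ => ?_⟩
  have := LinearMap.congr_fun hv (J.mkQ δ)
  rw [hB'] at this
  rw [mul_assoc, ← hm, this]
  rfl

end LocalAlgebraDual

section Trace

/-- A functional on the source of a linear map extends along it as soon as it kills the kernel. -/
theorem Module.Injective.exists_comp_eq_of_ker_le {k V W E : Type u} [CommRing k]
    [AddCommGroup V] [Module k V] [AddCommGroup W] [Module k W] [AddCommGroup E] [Module k E]
    [Module.Injective k E] (L : V →ₗ[k] W) (φ : V →ₗ[k] E)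
    (h : ∀ v, L v = 0 → φ v = 0) : ∃ ψ : W →ₗ[k] E, ∀ v, ψ (L v) = φ v := by
  obtain ⟨ψ, hψ⟩ := Module.Injective.out ((LinearMap.ker L).liftQ L le_rfl)
    (LinearMap.ker_eq_bot.mp (Submodule.ker_liftQ_eq_bot _ _ _ le_rfl))
    ((LinearMap.ker L).liftQ φ h)
  exact ⟨ψ, fun v => hψ ((LinearMap.ker L).mkQ v)⟩

variable {k : Type u} [CommRing k] {Λ : Type u} [Ring Λ] [Algebra k Λ]
  {E : Type u} [AddCommGroup E] [Module k E]
  {P₁ P₀ : Type u} [AddCommGroup P₁] [Module Λ P₁] [AddCommGroup P₀] [Module Λ P₀]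

/-- A functional `tr` on `Hom_Λ(P₁, X)` exhibiting `X` as the module which represents
`M ↦ D (coker (Hom_Λ(P₀, M) → Hom_Λ(P₁, M)))`. -/
structure IsRepresentingTrace (d : P₁ →ₗ[Λ] P₀) {X : Type u} [AddCommGroup X] [Module Λ X]
    [Module k X] [SMulCommClass Λ k X] (tr : (P₁ →ₗ[Λ] X) →ₗ[k] E) : Prop where
  comp_eq_zero : ∀ g : P₀ →ₗ[Λ] X, tr (g ∘ₗ d) = 0
  exists_eq : ∀ {M : Type u} [AddCommGroup M] [Module Λ M] [Module k M] [IsScalarTower k Λ M]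
    (χ : (P₁ →ₗ[Λ] M) →ₗ[k] E), (∀ g : P₀ →ₗ[Λ] M, χ (g ∘ₗ d) = 0) →
      ∃ f : M →ₗ[Λ] X, ∀ u, tr (f ∘ₗ u) = χ u
  exists_ne_zero : ∀ {M : Type u} [AddCommGroup M] [Module Λ M] (f : M →ₗ[Λ] X), f ≠ 0 →
    ∃ u, tr (f ∘ₗ u) ≠ 0

theorem DMod.isScalarTower {T : Type u} [AddCommGroup T] [Module Λᵐᵒᵖ T] [Module k T]
    [SMulCommClass Λᵐᵒᵖ k T] (h : ∀ (r : k) (a : Λ) (t : T),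
      MulOpposite.op (r • a) • t = r • MulOpposite.op a • t) :
    IsScalarTower k Λ (T →ₗ[k] E) where
  smul_assoc r a g := by
    ext t
    change g (MulOpposite.op (r • a) • t) = r • g (MulOpposite.op a • t)
    rw [h, map_smul]

theorem exists_dualBasis_of_projective (P : Type*) [AddCommGroup P] [Module Λ P]
    [Module.Finite Λ P] [Module.Projective Λ P] :
    ∃ (n : ℕ) (p : Fin n → P) (w : Fin n → P →ₗ[Λ] Λ), ∀ x, ∑ i, w i x • p i = x := by
  obtain ⟨n, f, g, -, -, h⟩ := Module.Finite.exists_comp_eq_id_of_projective Λ P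
  refine ⟨n, fun i => f (Pi.single i 1), fun i => LinearMap.proj i ∘ₗ g, fun x => ?_⟩
  conv_rhs => rw [← LinearMap.id_apply (R := Λ) x, ← h, LinearMap.comp_apply,
    ← (Pi.basisFun Λ (Fin n)).sum_repr (g x), map_sum]
  simp

theorem linearMap_eq_sum_smulRight {P M : Type*} [AddCommGroup P] [Module Λ P]
    [AddCommGroup M] [Module Λ M] {n : ℕ} {p : Fin n → P} {w : Fin n → P →ₗ[Λ] Λ}
    (h : ∀ x, ∑ i, w i x • p i = x) (u : P →ₗ[Λ] M) :
    u = ∑ i, (w i).smulRight (u (p i)) := by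
  ext x
  conv_lhs => rw [← h x, map_sum]
  simp [LinearMap.sum_apply]

/-- The evaluation trace on `Hom_Λ(P₁, D T)`, for `T` a cokernel of
`Hom_Λ(P₀, Λ) → Hom_Λ(P₁, Λ)`. -/
theorem exists_isRepresentingTrace [Module.Finite Λ P₁] [Module.Projective Λ P₁]
    [Module.Finite Λ P₀] [Module.Projective Λ P₀] (d : P₁ →ₗ[Λ] P₀)
    {T : Type u} [AddCommGroup T] [Module Λᵐᵒᵖ T] [Module k T] [SMulCommClass Λᵐᵒᵖ k T]
    (mk : (P₁ →ₗ[Λ] Λ) →ₗ[k] T) (hmk : Function.Surjective mk)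
    (hmk_smul : ∀ (a : Λ) (u : P₁ →ₗ[Λ] Λ),
      mk (MulOpposite.op a • u) = MulOpposite.op a • mk u)
    (hmk_zero : ∀ u, mk u = 0 ↔ ∃ v : P₀ →ₗ[Λ] Λ, v ∘ₗ d = u) :
    ∃ tr : (P₁ →ₗ[Λ] (T →ₗ[k] E)) →ₗ[k] E, IsRepresentingTrace d tr := by
  obtain ⟨n, p, w, hp⟩ := exists_dualBasis_of_projective (Λ := Λ) P₁
  obtain ⟨m, q, v, hq⟩ := exists_dualBasis_of_projective (Λ := Λ) P₀
  let tr : (P₁ →ₗ[Λ] (T →ₗ[k] E)) →ₗ[k] E :=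
    { toFun := fun u => ∑ i, u (p i) (mk (w i))
      map_add' := fun u u' => by simp [Finset.sum_add_distrib]
      map_smul' := fun r u => by simp [Finset.smul_sum] }
  have htr (u : P₁ →ₗ[Λ] Λ) (x : T →ₗ[k] E) : tr (u.smulRight x) = x (mk u) := by
    have hu : mk u = ∑ i, MulOpposite.op (u (p i)) • mk (w i) := by
      conv_lhs => rw [linearMap_eq_sum_smulRight hp u, map_sum]
      exact Finset.sum_congr rfl fun i _ => hmk_smul _ _
    rw [hu, map_sum]
    rfl
  refine ⟨tr, ?_, ?_, ?_⟩
  · intro g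
    have : g ∘ₗ d = ∑ j, (v j ∘ₗ d).smulRight (g (q j)) := by
      conv_lhs => rw [linearMap_eq_sum_smulRight hq g]
      ext x : 1
      simp [LinearMap.sum_apply]
    rw [this, map_sum]
    refine Finset.sum_eq_zero fun j _ => ?_
    rw [htr, (hmk_zero _).mpr ⟨v j, rfl⟩, map_zero]
  · intro M _ _ _ _ χ hχ
    let F (x : M) : (P₁ →ₗ[Λ] Λ) →ₗ[k] E :=
      { toFun := fun u => χ (u.smulRight x)
        map_add' := fun u u' => by
          rw [← map_add]
          congr 1
          ext y
          simp [add_smul]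
        map_smul' := fun r u => by
          rw [RingHom.id_apply, ← map_smul]
          congr 1
          ext y
          simp }
    have hF (x : M) : LinearMap.ker mk ≤ LinearMap.ker (F x) := by
      intro u hu
      obtain ⟨v, rfl⟩ := (hmk_zero u).mp hu
      exact hχ (v.smulRight x)
    let e := mk.quotKerEquivOfSurjective hmk
    let f' (x : M) : T →ₗ[k] E := (LinearMap.ker mk).liftQ (F x) (hF x) ∘ₗ e.symm.toLinearMap
    have hf' (x : M) (u : P₁ →ₗ[Λ] Λ) : f' x (mk u) = χ (u.smulRight x) := by
      have : e.symm (mk u) = (LinearMap.ker mk).mkQ u := by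
        rw [LinearEquiv.symm_apply_eq]
        rfl
      change (LinearMap.ker mk).liftQ (F x) (hF x) (e.symm (mk u)) = _
      rw [this]
      rfl
    let f : M →ₗ[Λ] (T →ₗ[k] E) :=
      { toFun := f'
        map_add' := fun x y => by
          ext t
          obtain ⟨u, rfl⟩ := hmk t
          rw [LinearMap.add_apply, hf', hf', hf', ← map_add]
          congr 1
          ext z
          simp
        map_smul' := fun a x => by
          ext t
          obtain ⟨u, rfl⟩ := hmk t
          change _ = f' x (MulOpposite.op a • mk u)
          rw [← hmk_smul, hf', hf']
          congr 1
          ext z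
          simp [mul_smul] }
    refine ⟨f, fun u => ?_⟩
    change ∑ i, f' (u (p i)) (mk (w i)) = χ u
    simp_rw [hf']
    rw [← map_sum, ← linearMap_eq_sum_smulRight hp u]
  · intro M _ _ f hf
    obtain ⟨x, hx⟩ : ∃ x, f x ≠ 0 := by
      by_contra! h
      exact hf (LinearMap.ext h)
    obtain ⟨t, ht⟩ : ∃ t, f x t ≠ 0 := by
      by_contra! h
      exact hx (LinearMap.ext h)
    obtain ⟨u, rfl⟩ := hmk t
    refine ⟨u.smulRight x, ?_⟩
    have : f ∘ₗ u.smulRight x = u.smulRight (f x) := by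
      ext y : 1
      simp
    rw [this, htr]
    exact ht

end Trace

section LinearMapFactorization

variable {R A B C : Type*} [Ring R] [AddCommGroup A] [Module R A] [AddCommGroup B] [Module R B]
  [AddCommGroup C] [Module R C]

theorem LinearMap.exists_comp_eq_of_surjective {q : A →ₗ[R] B} (hq : Function.Surjective q)
    (g : A →ₗ[R] C) (h : ∀ a, q a = 0 → g a = 0) : ∃ t : B →ₗ[R] C, t ∘ₗ q = g := by
  refine ⟨(LinearMap.ker q).liftQ g h ∘ₗ (q.quotKerEquivOfSurjective hq).symm.toLinearMap, ?_⟩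
  ext a
  have : (q.quotKerEquivOfSurjective hq).symm (q a) = (LinearMap.ker q).mkQ a := by
    rw [LinearEquiv.symm_apply_eq]
    rfl
  change (LinearMap.ker q).liftQ g h ((q.quotKerEquivOfSurjective hq).symm (q a)) = g a
  rw [this]
  rfl

theorem LinearMap.exists_comp_eq_of_injective {i : B →ₗ[R] C} (hi : Function.Injective i)
    (g : A →ₗ[R] C) (h : ∀ a, ∃ b, i b = g a) : ∃ t : A →ₗ[R] B, i ∘ₗ t = g := by
  refine ⟨(LinearEquiv.ofInjective i hi).symm.toLinearMap ∘ₗ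
    g.codRestrict (LinearMap.range i) h, ?_⟩
  ext a
  exact congrArg Subtype.val
    ((LinearEquiv.ofInjective i hi).apply_symm_apply (g.codRestrict (LinearMap.range i) h a))

theorem LinearMap.exists_pushout {R A B C : Type u} [Ring R] [AddCommGroup A] [Module R A]
    [AddCommGroup B] [Module R B] [AddCommGroup C] [Module R C] (i : A →ₗ[R] B) (f : A →ₗ[R] C) :
    ∃ (D : Type u) (_ : AddCommGroup D) (_ : Module R D) (inl : B →ₗ[R] D) (inr : C →ₗ[R] D),
      inl ∘ₗ i = inr ∘ₗ f ∧ (∀ x, ∃ b c, inl b + inr c = x) ∧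
      (∀ b c, inl b + inr c = 0 → ∃ a, i a = b ∧ f a = -c) ∧
      ∀ (Z : Type u) [AddCommGroup Z] [Module R Z] (g : B →ₗ[R] Z) (h : C →ₗ[R] Z),
        g ∘ₗ i = h ∘ₗ f → ∃ t : D →ₗ[R] Z, t ∘ₗ inl = g ∧ t ∘ₗ inr = h := by
  let S := LinearMap.range (i.prod (-f))
  have hmk (b : B) (c : C) : S.mkQ (b, 0) + S.mkQ (0, c) = S.mkQ (b, c) := by
    rw [← map_add, Prod.mk_add_mk, add_zero, zero_add]
  refine ⟨(B × C) ⧸ S, inferInstance, inferInstance, S.mkQ ∘ₗ LinearMap.inl R B C,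
    S.mkQ ∘ₗ LinearMap.inr R B C, ?_, ?_, ?_, ?_⟩
  · ext a
    refine (Submodule.Quotient.eq S).mpr ⟨a, ?_⟩
    simp
  · intro x
    obtain ⟨⟨b, c⟩, rfl⟩ := S.mkQ_surjective x
    exact ⟨b, c, hmk b c⟩
  · intro b c h
    obtain ⟨a, ha⟩ := (Submodule.Quotient.mk_eq_zero S).mp ((hmk b c).symm.trans h)
    obtain ⟨h₁, h₂⟩ := Prod.mk.inj ha
    exact ⟨a, h₁, neg_eq_iff_eq_neg.mp h₂⟩
  · intro Z _ _ g h hgh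
    refine ⟨S.liftQ (g.coprod h) ?_, ?_, ?_⟩
    · rintro _ ⟨a, rfl⟩
      have := LinearMap.congr_fun hgh a
      simp only [LinearMap.comp_apply] at this
      simp [this]
    · ext b
      simp
    · ext c
      simp

theorem LinearMap.exists_pullback {R A B C : Type u} [Ring R] [AddCommGroup A] [Module R A]
    [AddCommGroup B] [Module R B] [AddCommGroup C] [Module R C] (b : B →ₗ[R] A) (c : C →ₗ[R] A) :
    ∃ (D : Type u) (_ : AddCommGroup D) (_ : Module R D) (fst : D →ₗ[R] B) (snd : D →ₗ[R] C),
      b ∘ₗ fst = c ∘ₗ snd ∧ (∀ x y, fst x = fst y → snd x = snd y → x = y) ∧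
      (∀ y z, b y = c z → ∃ x, fst x = y ∧ snd x = z) ∧
      ∀ (M : Type u) [AddCommGroup M] [Module R M] (g : M →ₗ[R] B) (h : M →ₗ[R] C),
        b ∘ₗ g = c ∘ₗ h → ∃ t : M →ₗ[R] D, fst ∘ₗ t = g ∧ snd ∘ₗ t = h := by
  let S : Submodule R (B × C) :=
    LinearMap.eqLocus (b ∘ₗ LinearMap.fst R B C) (c ∘ₗ LinearMap.snd R B C)
  refine ⟨S, inferInstance, inferInstance, LinearMap.fst R B C ∘ₗ S.subtype,
    LinearMap.snd R B C ∘ₗ S.subtype, LinearMap.ext fun x => x.2,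
    fun x y h₁ h₂ => Subtype.ext (Prod.ext h₁ h₂), fun y z h => ⟨⟨(y, z), h⟩, rfl, rfl⟩, ?_⟩
  intro M _ _ g h hgh
  exact ⟨(g.prod h).codRestrict S fun x => LinearMap.congr_fun hgh x, rfl, rfl⟩

end LinearMapFactorization

section Presentation

/-- The maps `P₁ → K → P₀ → N` of a presentation of `N` with first syzygy `K`. -/
structure IsPresentation {Λ P₁ K P₀ N : Type*} [Ring Λ] [AddCommGroup P₁] [Module Λ P₁]
    [AddCommGroup K] [Module Λ K] [AddCommGroup P₀] [Module Λ P₀] [AddCommGroup N] [Module Λ N]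
    (p : P₁ →ₗ[Λ] K) (i : K →ₗ[Λ] P₀) (π : P₀ →ₗ[Λ] N) : Prop where
  surjective_fst : Function.Surjective p
  injective : Function.Injective i
  exact : Function.Exact i π
  surjective : Function.Surjective π

variable {Λ : Type u} [Ring Λ] {P₁ K P₀ N : Type u} [AddCommGroup P₁] [Module Λ P₁]
  [AddCommGroup K] [Module Λ K] [AddCommGroup P₀] [Module Λ P₀] [AddCommGroup N] [Module Λ N]
  {p : P₁ →ₗ[Λ] K} {i : K →ₗ[Λ] P₀} {π : P₀ →ₗ[Λ] N}

/-- An endomorphism of `N` together with a lift to an endomorphism of the presentation. -/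
structure IsEndLift (i : K →ₗ[Λ] P₀) (π : P₀ →ₗ[Λ] N) (γ : Module.End Λ N) (γ₀ : P₀ →ₗ[Λ] P₀)
    (γK : K →ₗ[Λ] K) : Prop where
  comp_right : π ∘ₗ γ₀ = γ ∘ₗ π
  comp_left : i ∘ₗ γK = γ₀ ∘ₗ i

namespace IsPresentation

theorem comp_eq_zero (hP : IsPresentation p i π) : π ∘ₗ i = 0 :=
  LinearMap.ext fun x => hP.exact.apply_apply_eq_zero x

theorem exists_comp_right {M : Type u} [AddCommGroup M] [Module Λ M] (hP : IsPresentation p i π)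
    (g : P₀ →ₗ[Λ] M) (h : g ∘ₗ i = 0) : ∃ t : N →ₗ[Λ] M, t ∘ₗ π = g := by
  refine LinearMap.exists_comp_eq_of_surjective hP.surjective g fun a ha => ?_
  obtain ⟨x, rfl⟩ := (hP.exact a).mp ha
  exact LinearMap.congr_fun h x

theorem exists_comp_left {M : Type u} [AddCommGroup M] [Module Λ M] (hP : IsPresentation p i π)
    (g : M →ₗ[Λ] P₀) (h : π ∘ₗ g = 0) : ∃ t : M →ₗ[Λ] K, i ∘ₗ t = g :=
  LinearMap.exists_comp_eq_of_injective hP.injective g fun a =>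
    (hP.exact _).mp (LinearMap.congr_fun h a)

theorem exists_isEndLift [Module.Projective Λ P₀] (hP : IsPresentation p i π)
    (γ : Module.End Λ N) : ∃ γ₀ γK, IsEndLift i π γ γ₀ γK := by
  obtain ⟨γ₀, h₀⟩ := Module.projective_lifting_property π (γ ∘ₗ π) hP.surjective
  obtain ⟨γK, hK⟩ := hP.exists_comp_left (γ₀ ∘ₗ i) (by
    rw [← LinearMap.comp_assoc, h₀, LinearMap.comp_assoc, hP.comp_eq_zero, LinearMap.comp_zero])
  exact ⟨γ₀, γK, h₀, hK⟩

/-- Every square from `i ∘ p` to `i` comes from an endomorphism of the presentation. -/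
theorem exists_isEndLift_of_comp_eq (hP : IsPresentation p i π) {u : P₁ →ₗ[Λ] K}
    {γ₀ : P₀ →ₗ[Λ] P₀} (h : i ∘ₗ u = γ₀ ∘ₗ i ∘ₗ p) :
    ∃ γ γK, IsEndLift i π γ γ₀ γK ∧ γK ∘ₗ p = u := by
  obtain ⟨γK, hK⟩ := hP.exists_comp_left (γ₀ ∘ₗ i) (by
    ext x
    obtain ⟨y, rfl⟩ := hP.surjective_fst x
    have := LinearMap.congr_fun h y
    simp only [LinearMap.comp_apply] at this
    simp only [LinearMap.comp_apply, ← this]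
    exact hP.exact.apply_apply_eq_zero _)
  obtain ⟨γ, hγ⟩ := hP.exists_comp_right (π ∘ₗ γ₀) (by
    rw [LinearMap.comp_assoc, ← hK, ← LinearMap.comp_assoc, hP.comp_eq_zero, LinearMap.zero_comp])
  refine ⟨γ, γK, ⟨hγ.symm, hK⟩, ?_⟩
  ext y
  apply hP.injective
  have h1 := LinearMap.congr_fun h y
  have h2 := LinearMap.congr_fun hK (p y)
  simp only [LinearMap.comp_apply] at h1 h2
  simp only [LinearMap.comp_apply, h1, h2]

end IsPresentation

end Presentation

section Extension

variable {k : Type u} [CommRing k] {Λ : Type u} [Ring Λ] [Algebra k Λ]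
  {E : Type u} [AddCommGroup E] [Module k E]
  {P₁ K P₀ N : Type u} [AddCommGroup P₁] [Module Λ P₁]
  [AddCommGroup K] [Module Λ K] [AddCommGroup P₀] [Module Λ P₀] [AddCommGroup N] [Module Λ N]
  {p : P₁ →ₗ[Λ] K} {i : K →ₗ[Λ] P₀} {π : P₀ →ₗ[Λ] N}
  {X : Type u} [AddCommGroup X] [Module Λ X] [Module k X] [IsScalarTower k Λ X]

/-- Postcomposition with a `Λ`-linear map, linear over the base ring. -/
def LinearMap.postcomp (k : Type*) {Λ P A B : Type*} [CommRing k] [Ring Λ] [Algebra k Λ]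
    [AddCommGroup P] [Module Λ P] [AddCommGroup A] [Module Λ A] [Module k A] [IsScalarTower k Λ A]
    [AddCommGroup B] [Module Λ B] [Module k B] [IsScalarTower k Λ B] (f : A →ₗ[Λ] B) :
    (P →ₗ[Λ] A) →ₗ[k] (P →ₗ[Λ] B) where
  toFun u := f ∘ₗ u
  map_add' u v := LinearMap.comp_add u v f
  map_smul' r u := by
    ext x
    exact map_smul_of_tower f r (u x)

/-- Precomposition with a `Λ`-linear map, linear over the base ring. -/
def LinearMap.precomp (k : Type*) {Λ P Q A : Type*} [CommRing k] [Ring Λ] [Algebra k Λ]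
    [AddCommGroup P] [Module Λ P] [AddCommGroup Q] [Module Λ Q]
    [AddCommGroup A] [Module Λ A] [Module k A] [IsScalarTower k Λ A] (f : P →ₗ[Λ] Q) :
    (Q →ₗ[Λ] A) →ₗ[k] (P →ₗ[Λ] A) where
  toFun u := u ∘ₗ f
  map_add' u v := LinearMap.add_comp f v u
  map_smul' _ _ := rfl

variable {tr : (P₁ →ₗ[Λ] X) →ₗ[k] E}

/-- A map `A → X` extends along a map `A → B` if and only if its trace vanishes on
all the maps `P₁ → A` which extend to `P₀ → B`. -/
theorem IsRepresentingTrace.exists_extension_iff [Module.Injective k E] {d : P₁ →ₗ[Λ] P₀}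
    (htr : IsRepresentingTrace d tr)
    {A B : Type u} [AddCommGroup A] [Module Λ A] [AddCommGroup B] [Module Λ B]
    (a : A →ₗ[Λ] B) (f : A →ₗ[Λ] X) :
    (∃ f' : B →ₗ[Λ] X, f' ∘ₗ a = f) ↔
      ∀ (u : P₁ →ₗ[Λ] A) (h : P₀ →ₗ[Λ] B), a ∘ₗ u = h ∘ₗ d → tr (f ∘ₗ u) = 0 := by
  constructor
  · rintro ⟨f', rfl⟩ u h hu
    rw [LinearMap.comp_assoc, hu, ← LinearMap.comp_assoc]
    exact htr.comp_eq_zero _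
  intro H
  let : Module k A := Module.compHom A (algebraMap k Λ)
  let : Module k B := Module.compHom B (algebraMap k Λ)
  have : IsScalarTower k Λ A := IsScalarTower.of_algebraMap_smul fun _ _ => rfl
  have : IsScalarTower k Λ B := IsScalarTower.of_algebraMap_smul fun _ _ => rfl
  obtain ⟨χ, hχ⟩ := Module.Injective.exists_comp_eq_of_ker_le
    ((LinearMap.postcomp k (P := P₁) a).coprod (-LinearMap.precomp k (A := B) d))
    (tr ∘ₗ LinearMap.postcomp k f ∘ₗ LinearMap.fst k _ (P₀ →ₗ[Λ] B)) (by
      rintro ⟨u, h⟩ huh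
      rw [LinearMap.coprod_apply, LinearMap.neg_apply, ← sub_eq_add_neg, sub_eq_zero] at huh
      exact H u h huh)
  obtain ⟨f', hf'⟩ := htr.exists_eq χ (fun g => by
    have := hχ (0, -g)
    simp only [LinearMap.coprod_apply, map_zero, zero_add, LinearMap.neg_apply, map_neg,
      neg_neg, LinearMap.comp_apply, LinearMap.fst_apply] at this
    exact this)
  refine ⟨f', ?_⟩
  by_contra hne
  obtain ⟨u, hu⟩ := htr.exists_ne_zero (f' ∘ₗ a - f) (sub_ne_zero.mpr hne)
  apply hu
  rw [LinearMap.sub_comp, map_sub, LinearMap.comp_assoc, hf', sub_eq_zero]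
  have := hχ (u, 0)
  simp only [LinearMap.coprod_apply, map_zero, add_zero] at this
  exact this

theorem IsRepresentingTrace.exists_extension_of_trace_eq_zero [Module.Injective k E]
    (htr : IsRepresentingTrace (i ∘ₗ p) tr) (hP : IsPresentation p i π) (g : K →ₗ[Λ] X)
    (h : ∀ γ γ₀ γK, IsEndLift i π γ γ₀ γK → tr (g ∘ₗ γK ∘ₗ p) = 0) :
    ∃ g' : P₀ →ₗ[Λ] X, g' ∘ₗ i = g := by
  refine (htr.exists_extension_iff i g).mpr fun u h₀ hu => ?_
  obtain ⟨γ, γK, hγ, rfl⟩ := hP.exists_isEndLift_of_comp_eq hu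
  exact h γ h₀ γK hγ

variable [Module k N] [IsScalarTower k Λ N]

theorem IsEndLift.add {γ δ : Module.End Λ N} {γ₀ δ₀ : P₀ →ₗ[Λ] P₀} {γK δK : K →ₗ[Λ] K}
    (hγ : IsEndLift i π γ γ₀ γK) (hδ : IsEndLift i π δ δ₀ δK) :
    IsEndLift i π (γ + δ) (γ₀ + δ₀) (γK + δK) :=
  ⟨by rw [LinearMap.comp_add, hγ.1, hδ.1, LinearMap.add_comp],
    by rw [LinearMap.comp_add, hγ.2, hδ.2, LinearMap.add_comp]⟩

theorem IsEndLift.mul {γ δ : Module.End Λ N} {γ₀ δ₀ : P₀ →ₗ[Λ] P₀} {γK δK : K →ₗ[Λ] K}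
    (hγ : IsEndLift i π γ γ₀ γK) (hδ : IsEndLift i π δ δ₀ δK) :
    IsEndLift i π (γ * δ) (γ₀ ∘ₗ δ₀) (γK ∘ₗ δK) :=
  ⟨by rw [← LinearMap.comp_assoc, hγ.1, LinearMap.comp_assoc, hδ.1]; rfl,
    by rw [← LinearMap.comp_assoc, hγ.2, LinearMap.comp_assoc, hδ.2]; rfl⟩

theorem IsEndLift.smul [Module k P₀] [IsScalarTower k Λ P₀] [Module k K] [IsScalarTower k Λ K]
    {γ : Module.End Λ N} {γ₀ : P₀ →ₗ[Λ] P₀} {γK : K →ₗ[Λ] K} (r : k)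
    (hγ : IsEndLift i π γ γ₀ γK) : IsEndLift i π (r • γ) (r • γ₀) (r • γK) := by
  constructor
  · have := (LinearMap.postcomp k (P := P₀) π).map_smul r γ₀
    exact this.trans (congrArg (r • ·) hγ.1)
  · have := (LinearMap.postcomp k (P := K) i).map_smul r γK
    exact this.trans (congrArg (r • ·) hγ.2)

/-- A functional on `End_Λ(N)` which kills the maps factoring through `P₀` comes from a map
`K → X`. -/
theorem IsRepresentingTrace.exists_trace_comp_eq [Module.Injective k E]
    (htr : IsRepresentingTrace (i ∘ₗ p) tr) (hP : IsPresentation p i π)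
    (φ : Module.End Λ N →ₗ[k] E) (hφ : ∀ s : N →ₗ[Λ] P₀, φ (π ∘ₗ s) = 0) :
    ∃ f : K →ₗ[Λ] X, ∀ γ γ₀ γK, IsEndLift i π γ γ₀ γK → tr (f ∘ₗ γK ∘ₗ p) = φ γ := by
  let : Module k K := Module.compHom K (algebraMap k Λ)
  let : Module k P₀ := Module.compHom P₀ (algebraMap k Λ)
  have : IsScalarTower k Λ K := IsScalarTower.of_algebraMap_smul fun _ _ => rfl
  have : IsScalarTower k Λ P₀ := IsScalarTower.of_algebraMap_smul fun _ _ => rfl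
  let V : Submodule k (Module.End Λ N × (P₀ →ₗ[Λ] P₀) × (K →ₗ[Λ] K)) :=
    { carrier := {x | IsEndLift i π x.1 x.2.1 x.2.2}
      add_mem' := fun hx hy => hx.add hy
      zero_mem' := ⟨by simp, by simp⟩
      smul_mem' := fun r _ hx => hx.smul r }
  obtain ⟨χ, hχ⟩ := Module.Injective.exists_comp_eq_of_ker_le
    (LinearMap.precomp k p ∘ₗ LinearMap.snd k _ _ ∘ₗ LinearMap.snd k _ _ ∘ₗ V.subtype)
    (φ ∘ₗ LinearMap.fst k _ _ ∘ₗ V.subtype) (by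
      rintro ⟨⟨γ, γ₀, γK⟩, hγ⟩ h
      replace hγ : IsEndLift i π γ γ₀ γK := hγ
      replace h : γK ∘ₗ p = 0 := h
      have hK : γK = 0 := by
        rw [← LinearMap.cancel_right hP.surjective_fst, h, LinearMap.zero_comp]
      obtain ⟨s, hs⟩ := hP.exists_comp_right γ₀ (by rw [← hγ.2, hK, LinearMap.comp_zero])
      have : γ = π ∘ₗ s := by
        rw [← LinearMap.cancel_right hP.surjective, ← hγ.1, ← hs, LinearMap.comp_assoc]
      change φ γ = 0
      rw [this, hφ])
  obtain ⟨f, hf⟩ := htr.exists_eq χ fun g =>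
    (hχ ⟨(0, i ∘ₗ g, g ∘ₗ i), by
      rw [← LinearMap.comp_assoc, hP.comp_eq_zero]
      simp, rfl⟩).trans (map_zero φ)
  exact ⟨f, fun γ γ₀ γK h => (hf _).trans (hχ ⟨(γ, γ₀, γK), h⟩)⟩

/-- The functional on `End_Λ(N)` attached to a map `K → X`. -/
theorem IsRepresentingTrace.exists_functional [Module.Projective Λ P₀]
    (htr : IsRepresentingTrace (i ∘ₗ p) tr) (hP : IsPresentation p i π) (g : K →ₗ[Λ] X) :
    ∃ θ : Module.End Λ N →ₗ[k] E,
      ∀ γ γ₀ γK, IsEndLift i π γ γ₀ γK → tr (g ∘ₗ γK ∘ₗ p) = θ γ := by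
  let : Module k K := Module.compHom K (algebraMap k Λ)
  let : Module k P₀ := Module.compHom P₀ (algebraMap k Λ)
  have : IsScalarTower k Λ K := IsScalarTower.of_algebraMap_smul fun _ _ => rfl
  have : IsScalarTower k Λ P₀ := IsScalarTower.of_algebraMap_smul fun _ _ => rfl
  have hindep {γ : Module.End Λ N} {γ₀ δ₀ : P₀ →ₗ[Λ] P₀} {γK δK : K →ₗ[Λ] K}
      (hγ : IsEndLift i π γ γ₀ γK) (hδ : IsEndLift i π γ δ₀ δK) :
      tr (g ∘ₗ γK ∘ₗ p) = tr (g ∘ₗ δK ∘ₗ p) := by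
    obtain ⟨h, hh⟩ := hP.exists_comp_left (γ₀ - δ₀) (by
      rw [LinearMap.comp_sub, hγ.1, hδ.1, sub_self])
    have hK : γK - δK = h ∘ₗ i := by
      rw [← LinearMap.cancel_left hP.injective, LinearMap.comp_sub, hγ.2, hδ.2,
        ← LinearMap.sub_comp, ← hh, LinearMap.comp_assoc]
    rw [← sub_eq_zero, ← map_sub, ← LinearMap.comp_sub, ← LinearMap.sub_comp, hK]
    exact htr.comp_eq_zero (g ∘ₗ h)
  choose lift₀ liftK hlift using fun γ => hP.exists_isEndLift γ
  refine ⟨{ toFun := fun γ => tr (g ∘ₗ liftK γ ∘ₗ p), map_add' := ?_, map_smul' := ?_ }, ?_⟩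
  · intro γ δ
    rw [hindep (hlift (γ + δ)) ((hlift γ).add (hlift δ)), LinearMap.add_comp,
      LinearMap.comp_add, map_add]
  · intro r γ
    rw [hindep (hlift (r • γ)) ((hlift γ).smul r), RingHom.id_apply, ← map_smul]
    exact congrArg tr ((LinearMap.postcomp k g).map_smul r (liftK γ ∘ₗ p))
  · intro γ γ₀ γK h
    exact hindep h (hlift γ)

end Extension

section AlmostSplitExtension

variable {k : Type u} [CommRing k] {Λ : Type u} [Ring Λ] [Algebra k Λ]
  {E : Type u} [AddCommGroup E] [Module k E]
  {P₁ K P₀ N : Type u} [AddCommGroup P₁] [Module Λ P₁]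
  [AddCommGroup K] [Module Λ K] [AddCommGroup P₀] [Module Λ P₀] [AddCommGroup N] [Module Λ N]
  [Module k N] [IsScalarTower k Λ N]
  {X Y : Type u} [AddCommGroup X] [Module Λ X] [Module k X] [IsScalarTower k Λ X]
  [AddCommGroup Y] [Module Λ Y]

/-- An extension `0 → X → Y → N → 0` together with a map from the presentation `P₁ → K → P₀ → N`
to it, such that the functional on `End_Λ(N)` attached to `K → X` is `φ`. -/
structure IsExtensionWithTrace (p : P₁ →ₗ[Λ] K) (i : K →ₗ[Λ] P₀) (π : P₀ →ₗ[Λ] N)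
    (tr : (P₁ →ₗ[Λ] X) →ₗ[k] E) (φ : Module.End Λ N →ₗ[k] E)
    (f : K →ₗ[Λ] X) (j : P₀ →ₗ[Λ] Y) (α : X →ₗ[Λ] Y) (β : Y →ₗ[Λ] N) : Prop where
  representing : IsRepresentingTrace (i ∘ₗ p) tr
  presentation : IsPresentation p i π
  trace_eq : ∀ γ γ₀ γK, IsEndLift i π γ γ₀ γK → tr (f ∘ₗ γK ∘ₗ p) = φ γ
  injective : Function.Injective α
  exact : Function.Exact α β
  surjective : Function.Surjective β
  comm_left : α ∘ₗ f = j ∘ₗ i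
  comm_right : β ∘ₗ j = π

namespace IsExtensionWithTrace

variable {p : P₁ →ₗ[Λ] K} {i : K →ₗ[Λ] P₀} {π : P₀ →ₗ[Λ] N}
  {tr : (P₁ →ₗ[Λ] X) →ₗ[k] E} {φ : Module.End Λ N →ₗ[k] E}
  {f : K →ₗ[Λ] X} {j : P₀ →ₗ[Λ] Y} {α : X →ₗ[Λ] Y} {β : Y →ₗ[Λ] N}

theorem comp_eq_zero (h : IsExtensionWithTrace p i π tr φ f j α β) : β ∘ₗ α = 0 :=
  LinearMap.ext fun x => h.exact.apply_apply_eq_zero x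

theorem exists_comp_left {M : Type u} [AddCommGroup M] [Module Λ M]
    (h : IsExtensionWithTrace p i π tr φ f j α β) (g : M →ₗ[Λ] Y) (hg : β ∘ₗ g = 0) :
    ∃ t : M →ₗ[Λ] X, α ∘ₗ t = g :=
  LinearMap.exists_comp_eq_of_injective h.injective g fun a =>
    (h.exact _).mp (LinearMap.congr_fun hg a)

theorem trace_eq_of_comp_eq [Module.Projective Λ P₀]
    (h : IsExtensionWithTrace p i π tr φ f j α β) {u : P₁ →ₗ[Λ] X} {h₀ : P₀ →ₗ[Λ] Y}
    (hu : α ∘ₗ u = h₀ ∘ₗ i ∘ₗ p) {γ : Module.End Λ N} (hγ : β ∘ₗ h₀ = γ ∘ₗ π) :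
    tr u = φ γ := by
  obtain ⟨γ₀, γK, hlift⟩ := h.presentation.exists_isEndLift γ
  obtain ⟨g, hg⟩ := h.exists_comp_left (h₀ - j ∘ₗ γ₀) (by
    rw [LinearMap.comp_sub, hγ, ← LinearMap.comp_assoc, h.comm_right, hlift.1, sub_self])
  have hu' : u = f ∘ₗ γK ∘ₗ p + g ∘ₗ i ∘ₗ p := by
    rw [← LinearMap.cancel_left h.injective, LinearMap.comp_add, ← LinearMap.comp_assoc _ _ α,
      ← LinearMap.comp_assoc _ _ α, h.comm_left, hg, hu, LinearMap.sub_comp,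
      LinearMap.comp_assoc, ← LinearMap.comp_assoc p γK i, hlift.2]
    simp only [LinearMap.comp_assoc]
    abel
  rw [hu', map_add, h.trace_eq γ γ₀ γK hlift, h.representing.comp_eq_zero, add_zero]

theorem not_exists_retraction [Module.Injective k E]
    (h : IsExtensionWithTrace p i π tr φ f j α β)
    (hφ : φ 1 ≠ 0) : ¬ ∃ r : Y →ₗ[Λ] X, r ∘ₗ α = LinearMap.id := by
  intro hr
  apply hφ
  rw [← h.trace_eq 1 LinearMap.id LinearMap.id ⟨rfl, rfl⟩]
  exact (h.representing.exists_extension_iff α LinearMap.id).mp hr (f ∘ₗ p) j (by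
    rw [← LinearMap.comp_assoc, h.comm_left, LinearMap.comp_assoc])

theorem not_exists_section [Module.Injective k E]
    (h : IsExtensionWithTrace p i π tr φ f j α β)
    (hφ : φ 1 ≠ 0) : ¬ ∃ s : N →ₗ[Λ] Y, β ∘ₗ s = LinearMap.id := by
  rintro ⟨s, hs⟩
  obtain ⟨r, hr⟩ := h.exists_comp_left (LinearMap.id - s ∘ₗ β) (by
    rw [LinearMap.comp_sub, ← LinearMap.comp_assoc, hs, LinearMap.comp_id, LinearMap.id_comp,
      sub_self])
  refine h.not_exists_retraction hφ ⟨r, ?_⟩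
  rw [← LinearMap.cancel_left h.injective, ← LinearMap.comp_assoc, hr, LinearMap.sub_comp,
    LinearMap.comp_assoc, h.comp_eq_zero, LinearMap.comp_zero, sub_zero, LinearMap.id_comp,
    LinearMap.comp_id]

theorem isRightAlmostSplitMap [Module.Injective k E] [Module.Projective Λ P₀]
    (h : IsExtensionWithTrace p i π tr φ f j α β)
    (hφ : φ 1 ≠ 0) (hφ' : ∀ γ, ¬ IsUnit γ → φ γ = 0) : IsRightAlmostSplitMap β := by
  refine ⟨h.not_exists_section hφ, fun Y' _ _ f' hf' => ?_⟩
  obtain ⟨Z, _, _, z₁, z₂, hz, hext, hmem, hlift⟩ := LinearMap.exists_pullback β f'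
  obtain ⟨a, ha₁, ha₂⟩ := hlift X α 0 (by rw [h.comp_eq_zero, LinearMap.comp_zero])
  obtain ⟨ρ, hρ⟩ := (h.representing.exists_extension_iff a LinearMap.id).mpr (by
    intro u h₀ hu
    obtain ⟨s, hs⟩ := h.presentation.exists_comp_right (z₂ ∘ₗ h₀) (by
      rw [← LinearMap.cancel_right h.presentation.surjective_fst, LinearMap.comp_assoc,
        LinearMap.comp_assoc, ← hu, ← LinearMap.comp_assoc, ha₂, LinearMap.zero_comp,
        LinearMap.zero_comp])
    have hγ : φ (f' ∘ₗ s) = 0 := hφ' _ fun ⟨v, hv⟩ => hf' ⟨s ∘ₗ (↑v⁻¹ : Module.End Λ N), by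
      rw [← LinearMap.comp_assoc, ← hv]
      exact v.mul_inv⟩
    rw [LinearMap.id_comp, ← hγ]
    refine h.trace_eq_of_comp_eq (h₀ := z₁ ∘ₗ h₀) ?_ ?_
    · rw [LinearMap.comp_assoc, ← hu, ← LinearMap.comp_assoc, ha₁]
    · rw [← LinearMap.comp_assoc, hz, LinearMap.comp_assoc, LinearMap.comp_assoc, hs])
  have hz₂ : Function.Surjective z₂ := fun y' => by
    obtain ⟨y, hy⟩ := h.surjective (f' y')
    obtain ⟨z, -, hz⟩ := hmem y y' hy
    exact ⟨z, hz⟩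
  obtain ⟨t, ht⟩ := LinearMap.exists_comp_eq_of_surjective hz₂ (z₁ - α ∘ₗ ρ) (by
    intro z hz0
    have h1 : β (z₁ z) = 0 := by
      have := LinearMap.congr_fun hz z
      rw [LinearMap.comp_apply, LinearMap.comp_apply, hz0, map_zero] at this
      exact this
    obtain ⟨x, hx⟩ := (h.exact _).mp h1
    have hax₁ : z₁ (a x) = α x := LinearMap.congr_fun ha₁ x
    have hax₂ : z₂ (a x) = 0 := LinearMap.congr_fun ha₂ x
    have hzx : z = a x := hext _ _ (hx.symm.trans hax₁.symm) (hz0.trans hax₂.symm)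
    have hρx : ρ (a x) = x := LinearMap.congr_fun hρ x
    rw [hzx, LinearMap.sub_apply, LinearMap.comp_apply, hρx, hax₁, sub_self])
  refine ⟨t, ?_⟩
  rw [← LinearMap.cancel_right hz₂, LinearMap.comp_assoc, ht, LinearMap.comp_sub,
    ← LinearMap.comp_assoc, h.comp_eq_zero, LinearMap.zero_comp, sub_zero, hz]

/-- If an endomorphism `e` of `X` extends to an endomorphism of `Y` over `N`, then a map `g : K → X`
extends to `P₀` as soon as `e ∘ g` does. -/
theorem exists_extension_of_exists_extension_comp [Module.Injective k E] [Module.Projective Λ P₀]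
    (h : IsExtensionWithTrace p i π tr φ f j α β) (hφ : φ 1 ≠ 0)
    (hsoc : ∀ ψ : Module.End Λ N →ₗ[k] E, ψ ≠ 0 → ∃ γ, ∀ δ, ψ (γ * δ) = φ δ)
    {e : X →ₗ[Λ] X} {τ : Y →ₗ[Λ] Y} (hτα : τ ∘ₗ α = α ∘ₗ e) (hτβ : β ∘ₗ τ = β)
    (g : K →ₗ[Λ] X) (hg : ∃ G : P₀ →ₗ[Λ] X, G ∘ₗ i = e ∘ₗ g) :
    ∃ g' : P₀ →ₗ[Λ] X, g' ∘ₗ i = g := by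
  by_contra hne
  obtain ⟨G, hG⟩ := hg
  obtain ⟨θ, hθ⟩ := h.representing.exists_functional h.presentation g
  have hθ0 : θ ≠ 0 := by
    rintro rfl
    exact hne (h.representing.exists_extension_of_trace_eq_zero h.presentation g hθ)
  obtain ⟨γ, hγ⟩ := hsoc θ hθ0
  obtain ⟨γ₀, γK, hlift⟩ := h.presentation.exists_isEndLift γ
  obtain ⟨b, hb⟩ := h.representing.exists_extension_of_trace_eq_zero h.presentation
    (g ∘ₗ γK - f) (by
      intro δ δ₀ δK hδ
      have := hθ _ _ _ (hlift.mul hδ)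
      rw [LinearMap.sub_comp, map_sub, h.trace_eq δ δ₀ δK hδ, ← hγ, ← this]
      simp only [LinearMap.comp_assoc, sub_self])
  have hef : e ∘ₗ f = (G ∘ₗ γ₀ - e ∘ₗ b) ∘ₗ i := by
    rw [LinearMap.sub_comp, LinearMap.comp_assoc, LinearMap.comp_assoc, ← hlift.2, hb,
      ← LinearMap.comp_assoc, hG, LinearMap.comp_sub, LinearMap.comp_assoc]
    abel
  obtain ⟨σ, hσ⟩ := h.presentation.exists_comp_right (τ ∘ₗ j - α ∘ₗ (G ∘ₗ γ₀ - e ∘ₗ b)) (by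
    rw [LinearMap.sub_comp, LinearMap.comp_assoc, LinearMap.comp_assoc, ← hef, ← h.comm_left,
      ← LinearMap.comp_assoc, hτα, LinearMap.comp_assoc, sub_self])
  refine h.not_exists_section hφ ⟨σ, ?_⟩
  rw [← LinearMap.cancel_right h.presentation.surjective, LinearMap.comp_assoc, hσ,
    LinearMap.comp_sub, ← LinearMap.comp_assoc, hτβ, h.comm_right, ← LinearMap.comp_assoc,
    h.comp_eq_zero, LinearMap.zero_comp, sub_zero, LinearMap.id_comp]

/-- If an endomorphism `e` of `X` extends to an endomorphism of `Y` over `N`, then a map into `X`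
extends along an injective map as soon as its composition with `e` does. -/
theorem exists_extension_of_exists_extension_comp_of_injective [Module.Injective k E]
    [Module.Projective Λ P₀]
    (h : IsExtensionWithTrace p i π tr φ f j α β) (hφ : φ 1 ≠ 0)
    (hsoc : ∀ ψ : Module.End Λ N →ₗ[k] E, ψ ≠ 0 → ∃ γ, ∀ δ, ψ (γ * δ) = φ δ)
    {e : X →ₗ[Λ] X} {τ : Y →ₗ[Λ] Y} (hτα : τ ∘ₗ α = α ∘ₗ e) (hτβ : β ∘ₗ τ = β)
    {A B : Type u} [AddCommGroup A] [Module Λ A] [AddCommGroup B] [Module Λ B]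
    {a : A →ₗ[Λ] B} (ha : Function.Injective a) (g : A →ₗ[Λ] X)
    (hg : ∃ G : B →ₗ[Λ] X, G ∘ₗ a = e ∘ₗ g) : ∃ g' : B →ₗ[Λ] X, g' ∘ₗ a = g := by
  obtain ⟨G, hG⟩ := hg
  refine (h.representing.exists_extension_iff a g).mpr fun u h₀ hu => ?_
  obtain ⟨v, rfl⟩ := LinearMap.exists_comp_eq_of_surjective h.presentation.surjective_fst u (by
    intro x hx
    apply ha
    have := LinearMap.congr_fun hu x
    simp only [LinearMap.comp_apply, hx, map_zero] at this
    rw [this, map_zero])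
  have hv : a ∘ₗ v = h₀ ∘ₗ i := by
    rw [← LinearMap.cancel_right h.presentation.surjective_fst, LinearMap.comp_assoc, hu,
      LinearMap.comp_assoc]
  obtain ⟨g', hg'⟩ := h.exists_extension_of_exists_extension_comp hφ hsoc hτα hτβ (g ∘ₗ v)
    ⟨G ∘ₗ h₀, by rw [LinearMap.comp_assoc, ← hv, ← LinearMap.comp_assoc, hG, LinearMap.comp_assoc]⟩
  rw [← LinearMap.comp_assoc, ← hg', LinearMap.comp_assoc]
  exact h.representing.comp_eq_zero g'

theorem injective_of_extends [Module.Injective k E] [Module.Projective Λ P₀]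
    (h : IsExtensionWithTrace p i π tr φ f j α β) (hφ : φ 1 ≠ 0)
    (hsoc : ∀ ψ : Module.End Λ N →ₗ[k] E, ψ ≠ 0 → ∃ γ, ∀ δ, ψ (γ * δ) = φ δ)
    [IsAtomic (Submodule Λ X)] (hmin : IsSuperfluousSubmodule (LinearMap.ker (i ∘ₗ p)))
    {e : X →ₗ[Λ] X} {τ : Y →ₗ[Λ] Y} (hτα : τ ∘ₗ α = α ∘ₗ e) (hτβ : β ∘ₗ τ = β) :
    Function.Injective e := by
  rw [← LinearMap.ker_eq_bot]
  refine (eq_bot_or_exists_atom_le (LinearMap.ker e)).resolve_right ?_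
  rintro ⟨S, hS, hSe⟩
  have hS' : IsSimpleModule Λ S := isSimpleModule_iff_isAtom.mpr hS
  have hS0 : S.subtype ≠ 0 := fun h0 => hS.1 (by
    rw [← Submodule.range_subtype S, h0, LinearMap.range_zero])
  obtain ⟨u, hu⟩ := h.representing.exists_ne_zero S.subtype hS0
  have hker : ∀ x, (i ∘ₗ p) x = 0 → u x = 0 := by
    intro x hx
    by_contra hux
    have htop := hmin (LinearMap.ker u) (by
      rw [eq_top_iff]
      intro y _
      obtain ⟨c, hc⟩ := IsSimpleModule.toSpanSingleton_surjective Λ hux (u y)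
      rw [LinearMap.toSpanSingleton_apply] at hc
      refine Submodule.mem_sup.mpr ⟨c • x, Submodule.smul_mem _ _ hx, y - c • x, ?_, by abel⟩
      rw [LinearMap.mem_ker, map_sub, map_smul, hc, sub_self])
    exact hux (LinearMap.mem_ker.mp (htop ▸ Submodule.mem_top))
  obtain ⟨B, _, _, inl, inr, hcomm, -, hzero, -⟩ := LinearMap.exists_pushout (i ∘ₗ p) u
  have hinr : Function.Injective inr := by
    rw [injective_iff_map_eq_zero]
    intro c hc
    obtain ⟨x, hx, hxc⟩ := hzero 0 c (by rw [hc, map_zero, add_zero])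
    rw [hker x hx] at hxc
    exact neg_eq_zero.mp hxc.symm
  have hext := h.exists_extension_of_exists_extension_comp_of_injective hφ hsoc hτα hτβ hinr
    S.subtype ⟨0, by
      ext x
      exact (hSe x.2).symm⟩
  exact hu ((h.representing.exists_extension_iff inr S.subtype).mp hext u inl hcomm.symm)

theorem isLeftAlmostSplitMap [Module.Injective k E] [Module.Projective Λ P₀]
    (h : IsExtensionWithTrace p i π tr φ f j α β) (hφ : φ 1 ≠ 0)
    (hφ' : ∀ γ, ¬ IsUnit γ → φ γ = 0)
    (hsoc : ∀ ψ : Module.End Λ N →ₗ[k] E, ψ ≠ 0 → ∃ γ, ∀ δ, ψ (γ * δ) = φ δ)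
    [IsAtomic (Submodule Λ X)] (hmin : IsSuperfluousSubmodule (LinearMap.ker (i ∘ₗ p))) :
    IsLeftAlmostSplitMap α := by
  refine ⟨h.not_exists_retraction hφ, fun Y' _ _ f' hf' => ?_⟩
  by_contra hne
  apply hf'
  obtain ⟨W, _, _, w, w', hcomm, hsurj, hzero, hlift⟩ := LinearMap.exists_pushout α f'
  obtain ⟨b, hbw, hbw'⟩ := hlift N β 0 (by rw [h.comp_eq_zero, LinearMap.zero_comp])
  have hw' : Function.Injective w' := by
    rw [injective_iff_map_eq_zero]
    intro c hc
    obtain ⟨x, hx, hxc⟩ := hzero 0 c (by rw [hc, map_zero, add_zero])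
    rw [h.injective (hx.trans (map_zero α).symm), map_zero] at hxc
    exact neg_eq_zero.mp hxc.symm
  have hb : ¬ ∃ s : N →ₗ[Λ] W, b ∘ₗ s = LinearMap.id := by
    rintro ⟨s, hs⟩
    obtain ⟨t, ht⟩ := LinearMap.exists_comp_eq_of_injective hw' (w - s ∘ₗ β) (by
      intro y
      have hby : b ((w - s ∘ₗ β) y) = 0 := by
        have h1 := LinearMap.congr_fun hbw y
        have h2 := LinearMap.congr_fun hs (β y)
        simp only [LinearMap.comp_apply, LinearMap.id_apply] at h1 h2
        simp only [LinearMap.sub_apply, LinearMap.comp_apply, map_sub, h1, h2, sub_self]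
      obtain ⟨y₁, c, hyc⟩ := hsurj ((w - s ∘ₗ β) y)
      rw [← hyc] at hby ⊢
      have h1 := LinearMap.congr_fun hbw y₁
      have h2 := LinearMap.congr_fun hbw' c
      rw [LinearMap.comp_apply] at h1 h2
      rw [map_add, h1, h2, LinearMap.zero_apply, add_zero] at hby
      obtain ⟨x, rfl⟩ := (h.exact _).mp hby
      refine ⟨f' x + c, ?_⟩
      have := LinearMap.congr_fun hcomm x
      simp only [LinearMap.comp_apply] at this
      rw [map_add, this])
    refine hne ⟨t, ?_⟩
    rw [← LinearMap.cancel_left hw', ← LinearMap.comp_assoc, ht, LinearMap.sub_comp,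
      LinearMap.comp_assoc, h.comp_eq_zero, LinearMap.comp_zero, sub_zero, hcomm]
  obtain ⟨t, ht⟩ := (h.isRightAlmostSplitMap hφ hφ').2 W inferInstance inferInstance b hb
  obtain ⟨r, hr⟩ := h.exists_comp_left (t ∘ₗ w') (by
    rw [← LinearMap.comp_assoc, ht, hbw'])
  have hτα : (t ∘ₗ w) ∘ₗ α = α ∘ₗ (r ∘ₗ f') := by
    rw [LinearMap.comp_assoc, hcomm, ← LinearMap.comp_assoc, ← hr, LinearMap.comp_assoc]
  have hτβ : β ∘ₗ (t ∘ₗ w) = β := by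
    rw [← LinearMap.comp_assoc, ht, hbw]
  obtain ⟨s, hs⟩ := h.exists_extension_of_exists_extension_comp_of_injective hφ hsoc hτα hτβ
    (h.injective_of_extends hφ hsoc hmin hτα hτβ) LinearMap.id ⟨LinearMap.id, rfl⟩
  exact ⟨s ∘ₗ r, by rw [LinearMap.comp_assoc, hs]⟩

end IsExtensionWithTrace

end AlmostSplitExtension

section Finiteness

theorem Module.Finite.linearMap_of_isNoetherian {k Λ P M : Type*} [CommRing k] [Ring Λ]
    [Algebra k Λ] [AddCommGroup P] [Module Λ P] [Module.Finite Λ P] [AddCommGroup M] [Module Λ M]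
    [Module k M] [SMulCommClass Λ k M] [IsNoetherian k M] :
    Module.Finite k (P →ₗ[Λ] M) := by
  obtain ⟨n, s, hs⟩ := Module.Finite.exists_fin (R := Λ) (M := P)
  let ev : (P →ₗ[Λ] M) →ₗ[k] (Fin n → M) :=
    { toFun := fun u j => u (s j)
      map_add' := fun _ _ => rfl
      map_smul' := fun _ _ => rfl }
  refine Module.Finite.of_injective ev fun u v huv => ?_
  refine LinearMap.ext_on_range hs fun j => ?_
  exact congrFun huv j

theorem isAtomic_submodule_of_isArtinian_span_singleton {R M : Type*} [Ring R] [AddCommGroup M]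
    [Module R M] (h : ∀ x : M, IsArtinian R (Submodule.span R {x})) :
    IsAtomic (Submodule R M) := by
  refine ⟨fun S => or_iff_not_imp_left.mpr fun hS => ?_⟩
  obtain ⟨x, hxS, hx⟩ := S.ne_bot_iff.mp hS
  have := h x
  have hnt : (⊤ : Submodule R (Submodule.span R {x})) ≠ ⊥ := by
    rw [Submodule.ne_bot_iff]
    exact ⟨⟨x, Submodule.mem_span_singleton_self x⟩, trivial, fun h => hx (congrArg Subtype.val h)⟩
  obtain ⟨m, hm, -⟩ := (eq_bot_or_exists_atom_le _).resolve_left hnt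
  refine ⟨m.map (Submodule.span R {x}).subtype, ?_, ?_⟩
  · have := isSimpleModule_iff_isAtom.mpr hm
    exact isSimpleModule_iff_isAtom.mp (IsSimpleModule.congr
      (Submodule.equivMapOfInjective _ (Submodule.injective_subtype _) m).symm)
  · refine (Submodule.map_subtype_le _ _).trans ?_
    rwa [Submodule.span_singleton_le_iff_mem]

theorem Module.End.eq_zero_or_eq_one_of_isIdempotentElem {Λ N : Type u} [Ring Λ] [AddCommGroup N]
    [Module Λ N]
    (hN : ∀ (A B : Type u) (_ : AddCommGroup A) (_ : Module Λ A)
      (_ : AddCommGroup B) (_ : Module Λ B),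
      Nonempty (N ≃ₗ[Λ] A × B) → Subsingleton A ∨ Subsingleton B)
    (e : Module.End Λ N) (he : IsIdempotentElem e) : e = 0 ∨ e = 1 := by
  have hcompl := LinearMap.IsIdempotentElem.isCompl he
  rcases hN _ _ _ _ _ _ ⟨(Submodule.prodEquivOfIsCompl _ _ hcompl).symm⟩ with h | h
  · left
    exact LinearMap.range_eq_bot.mp (Submodule.subsingleton_iff_eq_bot.mp h)
  · right
    have hinj := LinearMap.ker_eq_bot.mp (Submodule.subsingleton_iff_eq_bot.mp h)
    ext x
    exact hinj (LinearMap.congr_fun he x)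

end Finiteness

section Existence

open IsLocalRing

variable {k : Type u} [CommRing k] [IsNoetherianRing k] [IsLocalRing k]
  {Λ : Type u} [Ring Λ] [Algebra k Λ] [Module.Finite k Λ]
  {E : Type u} [AddCommGroup E] [Module k E] {ι : (k ⧸ maximalIdeal k) →ₗ[k] E}

theorem isAtomic_submodule_dual (hess : ∀ L : Submodule k E, L ⊓ LinearMap.range ι = ⊥ → L = ⊥)
    (T : Type u) [AddCommGroup T] [Module Λᵐᵒᵖ T] [Module k T] [SMulCommClass Λᵐᵒᵖ k T]
    [Module.Finite k T] [IsScalarTower k Λ (T →ₗ[k] E)] :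
    IsAtomic (Submodule Λ (T →ₗ[k] E)) := by
  refine isAtomic_submodule_of_isArtinian_span_singleton fun x => ?_
  have : Module.Finite k (Submodule.span Λ {x}) := Module.Finite.trans Λ _
  have := isArtinian_of_injective_linearMap hess
    ((Submodule.span Λ {x}).subtype.restrictScalars k) (Submodule.injective_subtype _)
  exact isArtinian_of_tower k this

/-- The almost split sequence ending in `N`, with `Tr N` replaced by any cokernel `T` of
`Hom_Λ(P₀, Λ) → Hom_Λ(P₁, Λ)`. -/
theorem exists_almostSplit_sequence [IsAdicComplete (maximalIdeal k) k] [Module.Injective k E]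
    (hι : Function.Injective ι)
    (hess : ∀ L : Submodule k E, L ⊓ LinearMap.range ι = ⊥ → L = ⊥)
    {N P₁ P₀ : Type u} [AddCommGroup N] [Module Λ N]
    [AddCommGroup P₁] [Module Λ P₁] [AddCommGroup P₀] [Module Λ P₀]
    [Module.Projective Λ P₁] [Module.Finite Λ P₁]
    [Module.Projective Λ P₀] [Module.Finite Λ P₀] [Nontrivial N]
    (hN : ∀ (A B : Type u) (_ : AddCommGroup A) (_ : Module Λ A)
      (_ : AddCommGroup B) (_ : Module Λ B),
      Nonempty (N ≃ₗ[Λ] A × B) → Subsingleton A ∨ Subsingleton B)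
    (hNproj : ¬ Module.Projective Λ N)
    (d : P₁ →ₗ[Λ] P₀) (π : P₀ →ₗ[Λ] N) (hπ : Function.Surjective π)
    (hexact : LinearMap.range d = LinearMap.ker π)
    (hdmin : IsSuperfluousSubmodule (LinearMap.ker d))
    {T : Type u} [AddCommGroup T] [Module Λᵐᵒᵖ T] [Module k T] [SMulCommClass Λᵐᵒᵖ k T]
    (mk : (P₁ →ₗ[Λ] Λ) →ₗ[k] T) (hmk : Function.Surjective mk)
    (hmk_smul : ∀ (a : Λ) (u : P₁ →ₗ[Λ] Λ),
      mk (MulOpposite.op a • u) = MulOpposite.op a • mk u)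
    (hmk_zero : ∀ u, mk u = 0 ↔ ∃ v : P₀ →ₗ[Λ] Λ, v ∘ₗ d = u) :
    ∃ (Y : Type u) (_ : AddCommGroup Y) (_ : Module Λ Y)
      (α : (T →ₗ[k] E) →ₗ[Λ] Y) (β : Y →ₗ[Λ] N),
      Function.Injective α ∧ LinearMap.range α = LinearMap.ker β ∧
        Function.Surjective β ∧
        IsLeftAlmostSplitMap α ∧ IsRightAlmostSplitMap β := by
  have : IsNoetherian k Λ := isNoetherian_of_isNoetherianRing_of_finite k Λ
  have : Module.Finite k (P₁ →ₗ[Λ] Λ) := Module.Finite.linearMap_of_isNoetherian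
  have : Module.Finite k T := Module.Finite.of_surjective mk hmk
  have : IsScalarTower k Λ (T →ₗ[k] E) := DMod.isScalarTower (by
    intro r a t
    obtain ⟨u, rfl⟩ := hmk t
    rw [← hmk_smul, ← hmk_smul, ← map_smul]
    congr 1
    ext x
    exact mul_smul_comm r (u x) a)
  have := isAtomic_submodule_dual (Λ := Λ) hess T
  let : Module k N := Module.compHom N (algebraMap k Λ)
  have : IsScalarTower k Λ N := IsScalarTower.of_algebraMap_smul fun _ _ => rfl
  have : Module.Finite Λ N := Module.Finite.of_surjective π hπ
  have : Module.Finite k N := Module.Finite.trans Λ N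
  have : IsNoetherian k N := isNoetherian_of_isNoetherianRing_of_finite k N
  have : Module.Finite k (Module.End Λ N) := Module.Finite.linearMap_of_isNoetherian
  have : IsLocalRing (Module.End Λ N) := IsLocalRing.of_isUnit_or_isUnit_one_sub_self
    (isUnit_or_isUnit_one_sub_of_isIdempotentElem (k := k)
      (Module.End.eq_zero_or_eq_one_of_isIdempotentElem hN))
  obtain ⟨φ, hφ, hφ', hsoc⟩ := exists_generator_socle_dual hι hess (Module.End Λ N)
  let i := (LinearMap.ker π).subtype
  let p := d.codRestrict (LinearMap.ker π) fun x => hexact ▸ ⟨x, rfl⟩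
  have hd : i ∘ₗ p = d := rfl
  have hP : IsPresentation p i π := by
    refine ⟨?_, Submodule.injective_subtype _, ?_, hπ⟩
    · rintro ⟨x, hx⟩
      rw [← hexact] at hx
      obtain ⟨y, rfl⟩ := hx
      exact ⟨y, rfl⟩
    · rw [LinearMap.exact_iff, Submodule.range_subtype]
  obtain ⟨tr, htr⟩ := exists_isRepresentingTrace (E := E) d mk hmk hmk_smul hmk_zero
  rw [← hd] at htr
  obtain ⟨f, hf⟩ := htr.exists_trace_comp_eq hP φ fun s => hφ' _ fun ⟨v, hv⟩ =>
    hNproj (Module.Projective.of_split (s ∘ₗ (↑v⁻¹ : Module.End Λ N)) π (by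
      rw [← LinearMap.comp_assoc, ← hv]
      exact v.mul_inv))
  obtain ⟨Y, _, _, j, α, hcomm, hsurj, hzero, hlift⟩ := LinearMap.exists_pushout i f
  obtain ⟨β, hβj, hβα⟩ := hlift N π 0 (by rw [hP.comp_eq_zero, LinearMap.zero_comp])
  have hα : Function.Injective α := by
    rw [injective_iff_map_eq_zero]
    intro c hc
    obtain ⟨x, hx, hxc⟩ := hzero 0 c (by rw [hc, map_zero, add_zero])
    rw [hP.injective (hx.trans (map_zero i).symm), map_zero] at hxc
    exact neg_eq_zero.mp hxc.symm
  have hαβ : Function.Exact α β := by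
    intro y
    constructor
    · intro hy
      obtain ⟨b, c, rfl⟩ := hsurj y
      have h1 := LinearMap.congr_fun hβj b
      have h2 := LinearMap.congr_fun hβα c
      rw [LinearMap.comp_apply] at h1 h2
      rw [map_add, h1, h2, LinearMap.zero_apply, add_zero] at hy
      obtain ⟨x, rfl⟩ := (hP.exact b).mp hy
      have h3 : j (i x) = α (f x) := LinearMap.congr_fun hcomm x
      exact ⟨f x + c, by rw [map_add, h3]⟩
    · rintro ⟨x, rfl⟩
      exact LinearMap.congr_fun hβα x
  have hβ : Function.Surjective β := fun x => by
    obtain ⟨y, rfl⟩ := hπ x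
    exact ⟨j y, LinearMap.congr_fun hβj y⟩
  have h : IsExtensionWithTrace p i π tr φ f j α β :=
    ⟨htr, hP, hf, hα, hαβ, hβ, hcomm.symm, hβj⟩
  exact ⟨Y, inferInstance, inferInstance, α, β, hα, (LinearMap.exact_iff.mp hαβ).symm, hβ,
    h.isLeftAlmostSplitMap hφ hφ' hsoc hdmin, h.isRightAlmostSplitMap hφ hφ'⟩

end Existence

section Transpose

theorem transposeOf.exists_mk (k : Type u) [CommRing k] {Λ : Type u} [Ring Λ] [Algebra k Λ]
    {P₁ P₀ : Type u} [AddCommGroup P₁] [Module Λ P₁] [AddCommGroup P₀] [Module Λ P₀]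
    (d : P₁ →ₗ[Λ] P₀) :
    ∃ mk : (P₁ →ₗ[Λ] Λ) →ₗ[k] transposeOf d, Function.Surjective mk ∧
      (∀ (a : Λ) (u : P₁ →ₗ[Λ] Λ), mk (MulOpposite.op a • u) = MulOpposite.op a • mk u) ∧
      ∀ u, mk u = 0 ↔ ∃ v : P₀ →ₗ[Λ] Λ, v ∘ₗ d = u := by
  let mk : (P₁ →ₗ[Λ] Λ) →ₗ[k] transposeOf d :=
    { toFun := Submodule.Quotient.mk
      map_add' := fun _ _ => rfl
      map_smul' := fun r u => Submodule.Quotient.mk_smul _ r u }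
  have hmk (u : P₁ →ₗ[Λ] Λ) : mk u = Submodule.Quotient.mk u := rfl
  refine ⟨mk, ?_, ?_, ?_⟩
  · intro t
    obtain ⟨u, rfl⟩ := Submodule.Quotient.mk_surjective _ t
    exact ⟨u, rfl⟩
  · intro a u
    rw [hmk, hmk, Submodule.Quotient.mk_smul]
  · intro u
    rw [hmk, Submodule.Quotient.mk_eq_zero]
    rfl

end Transpose

/-- let `N` be a finitely presented `Λ`-module which is indecomposable and
not projective, with a minimal projective presentation `P₁ → P₀ → N → 0` by finitely
generated projective modules.  Then there exists an almost split sequence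
`0 → D Tr N → Y → N → 0` of `Λ`-modules, where `D Tr N = Hom_k(Tr N, E)` is computed from
the given presentation. -/
theorem stmt_11 (k : Type u) [CommRing k] [IsNoetherianRing k] [IsLocalRing k]
    [IsAdicComplete (IsLocalRing.maximalIdeal k) k]
    (Λ : Type u) [Ring Λ] [Algebra k Λ] [Module.Finite k Λ]
    (E : Type u) [AddCommGroup E] [Module k E] [Module.Injective k E]
    (ι : (k ⧸ IsLocalRing.maximalIdeal k) →ₗ[k] E) (hι : Function.Injective ι)
    (hess : ∀ L : Submodule k E, L ⊓ LinearMap.range ι = ⊥ → L = ⊥)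
    (N P₁ P₀ : Type u)
    [AddCommGroup N] [Module Λ N]
    [AddCommGroup P₁] [Module Λ P₁] [AddCommGroup P₀] [Module Λ P₀]
    [Module.Projective Λ P₁] [Module.Finite Λ P₁]
    [Module.Projective Λ P₀] [Module.Finite Λ P₀]
    (hNind₁ : Nontrivial N)
    (hNind₂ : ∀ (A B : Type u) (_ : AddCommGroup A) (_ : Module Λ A)
      (_ : AddCommGroup B) (_ : Module Λ B),
      Nonempty (N ≃ₗ[Λ] A × B) → Subsingleton A ∨ Subsingleton B)
    (hNproj : ¬ Module.Projective Λ N)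
    (d : P₁ →ₗ[Λ] P₀) (π : P₀ →ₗ[Λ] N)
    (hπ : Function.Surjective π)
    (hπmin : IsSuperfluousSubmodule (LinearMap.ker π))
    (hexact : LinearMap.range d = LinearMap.ker π)
    (hdmin : IsSuperfluousSubmodule (LinearMap.ker d)) :
    ∃ (Y : Type u) (_ : AddCommGroup Y) (_ : Module Λ Y)
      (α : ((transposeOf d) →ₗ[k] E) →ₗ[Λ] Y) (β : Y →ₗ[Λ] N),
      Function.Injective α ∧ LinearMap.range α = LinearMap.ker β ∧
        Function.Surjective β ∧
        IsLeftAlmostSplitMap α ∧ IsRightAlmostSplitMap β := by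
  obtain ⟨mk, hmk, hmk_smul, hmk_zero⟩ := transposeOf.exists_mk k d
  exact exists_almostSplit_sequence hι hess hNind₂ hNproj d π hπ hexact hdmin mk hmk hmk_smul
    hmk_zero
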